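/- Let Ω ⊂ ℝ^N (N ≥ 2) be a smooth bounded open set with (−8,8)^N ⊂ Ω, let 1 < r ≤ N be an integer, and let 1 < p < ∞ and 0 < s < ∞ be such that W^{s,p}(Ω) is not contained in W^{2−2/r,r}(Ω); equivalently, s − 2 + 2/r < max{0, N/p − N/r}, or (p > r and s = 2 − 2/r is not an integer). Then there exist a sequence of scalar functions {u_k} ⊂ C^2(Ω̄) and a function ψ ∈ C_c^∞(Ω) such that ‖u_k‖_{W^{s,p}(Ω)} → 0 and ∫_Ω M^{α'}_{α'}(D^2 u_k) ψ dx → +∞ as k → ∞, where α' = (1,2,…,r) and M^{α'}_{α'}(D^2 u_k) is the determinant of the r×r submatrix of the Hessian of u_k with rows and columns indexed by α'. -/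

import Mathlib

open MeasureTheory Filter Topology Real

noncomputable section

abbrev Euc (N : ℕ) := EuclideanSpace ℝ (Fin N)

/-- The (full signed) determinant of an `m`-dimensional matrix of order `N^m`:
`det A = ∑_{τ_2,…,τ_m ∈ S_N} (∏_{s=2}^m sgn τ_s) ∏_{k=1}^N a_{k τ_2(k) ⋯ τ_m(k)}`. -/
def hyperDet {N : ℕ} : {m : ℕ} → ((Fin m → Fin N) → ℝ) → ℝ
  | 0, A => A finZeroElim
  | m + 1, A =>
      ∑ τ : Fin m → Equiv.Perm (Fin N),
        (∏ s, ((Equiv.Perm.sign (τ s) : ℤ) : ℝ)) *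
          ∏ k : Fin N, A (Fin.cons k fun s => τ s k)

/-- classical partial derivative `∂_i f`. -/
def pderiv' {N : ℕ} (i : Fin N) (f : Euc N → ℝ) : Euc N → ℝ :=
  fun x => fderiv ℝ f x (EuclideanSpace.single i 1)

/-- iterated partial derivative `∂_{l_1} ∂_{l_2} ⋯ f`. -/
def pderivList {N : ℕ} : List (Fin N) → (Euc N → ℝ) → Euc N → ℝ
  | [], f => f
  | i :: l, f => pderiv' i (pderivList l f)

/-- the `m`th-Jacobian `(β,α)`-minor `M^β_α(D^m u)` of `u : Ω → ℝ^n`, i.e. the hyper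
determinant of the `(m+1)`-dimensional matrix of order `r^{m+1}` with entries
`∂_{α^1_{l_1}} ⋯ ∂_{α^m_{l_m}} u^{β_{l_0}}`. -/
def jacMinor {N n : ℕ} (m r : ℕ) (β : Fin r → Fin n) (α : Fin m → Fin r → Fin N)
    (u : Euc N → Fin n → ℝ) (x : Euc N) : ℝ :=
  hyperDet (m := m + 1) fun l : Fin (m + 1) → Fin r =>
    pderivList (List.ofFn fun s : Fin m => α s (l s.succ)) (fun y => u y (β (l 0))) x

/-- the `m`th-Jacobian `α`-minor `M_α(D^m v)` of a scalar function `v`. -/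
def scalMinor {N : ℕ} (m r : ℕ) (α : Fin m → Fin r → Fin N)
    (v : Euc N → ℝ) (x : Euc N) : ℝ :=
  hyperDet (m := m) fun l : Fin m → Fin r =>
    pderivList (List.ofFn fun s : Fin m => α s (l s)) v x

/-- the integer Sobolev norm `‖u‖_{W^{k,p}(Ω)} = ∑_{j ≤ k} ‖D^j u‖_{L^p(Ω)}`. -/
def intSobNorm {N : ℕ} {F : Type*} [NormedAddCommGroup F] [NormedSpace ℝ F]
    (Ω : Set (Euc N)) (k : ℕ) (p : ℝ) (u : Euc N → F) : ℝ :=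
  ∑ j ∈ Finset.range (k + 1), (∫ x in Ω, ‖iteratedFDeriv ℝ j u x‖ ^ p) ^ (1 / p)

open Classical in
/-- the (possibly fractional) Sobolev norm `‖u‖_{W^{s,p}(Ω)}`: for integer `s` the usual
Sobolev norm, for non-integer `s` the `W^{[s],p}` norm plus the Gagliardo seminorm of
`D^{[s]} u` with fractional exponent `s - [s]`. -/
def sobNorm {N : ℕ} {F : Type*} [NormedAddCommGroup F] [NormedSpace ℝ F]
    (Ω : Set (Euc N)) (s p : ℝ) (u : Euc N → F) : ℝ :=
  if ∃ k : ℕ, s = k then intSobNorm Ω ⌊s⌋₊ p u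
  else
    intSobNorm Ω ⌊s⌋₊ p u +
      (∫ x in Ω, ∫ y in Ω,
          ‖iteratedFDeriv ℝ ⌊s⌋₊ u x - iteratedFDeriv ℝ ⌊s⌋₊ u y‖ ^ p /
            ‖x - y‖ ^ ((N : ℝ) + (s - ⌊s⌋₊) * p)) ^ (1 / p)

/-- `‖D^m ψ‖_{L^∞}`, the sup of the `m`-th derivatives of `ψ`. -/
def supDm {N : ℕ} (m : ℕ) (ψ : Euc N → ℝ) : ℝ := ⨆ x, ‖iteratedFDeriv ℝ m ψ x‖

/-- `ψ ∈ C_c^∞(Ω)`. -/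
def IsCinfc {N : ℕ} (Ω : Set (Euc N)) (ψ : Euc N → ℝ) : Prop :=
  ContDiff ℝ (⊤ : ℕ∞) ψ ∧ HasCompactSupport ψ ∧ tsupport ψ ⊆ Ω

/-- `Ω` is a smooth bounded open subset of `ℝ^N`. -/
def IsSmoothDomain {N : ℕ} (Ω : Set (Euc N)) : Prop :=
  IsOpen Ω ∧ Bornology.IsBounded Ω ∧
    ∃ f : Euc N → ℝ, ContDiff ℝ (⊤ : ℕ∞) f ∧ Ω = {x | f x < 0} ∧
      ∀ x ∈ frontier Ω, fderiv ℝ f x ≠ 0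

theorem det_diagonal_add_rankOne {n : Type*} [Fintype n] [DecidableEq n] (d v : n → ℝ) :
    (Matrix.diagonal d + Matrix.replicateCol Unit v * Matrix.replicateRow Unit v).det =
      ∏ a, d a + ∑ a, v a ^ 2 * ∏ l ∈ Finset.univ.erase a, d l := by
  have key : ∀ e : n → ℝ, (∀ a, e a ≠ 0) →
      (Matrix.diagonal e + Matrix.replicateCol Unit v * Matrix.replicateRow Unit v).det =
        ∏ a, e a + ∑ a, v a ^ 2 * ∏ l ∈ Finset.univ.erase a, e l := by
    intro e he
    have hdet : (Matrix.diagonal e).det ≠ 0 := by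
      rw [Matrix.det_diagonal]; exact Finset.prod_ne_zero_iff.2 fun a _ => he a
    have hinv : (Matrix.diagonal e)⁻¹ = Matrix.diagonal fun a => (e a)⁻¹ := by
      apply Matrix.inv_eq_right_inv
      rw [Matrix.diagonal_mul_diagonal, ← Matrix.diagonal_one]
      congr 1
      ext a
      simp [he a]
    rw [Matrix.det_add_replicateCol_mul_replicateRow hdet.isUnit, hinv, Matrix.det_diagonal,
      Matrix.det_unique, Matrix.mul_assoc]
    simp only [Matrix.add_apply, Matrix.one_apply_eq,
      Matrix.mul_apply (M := Matrix.replicateRow Unit v),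
      Matrix.diagonal_mul, Matrix.replicateRow_apply, Matrix.replicateCol_apply, mul_add,
      mul_one, Finset.mul_sum]
    congr 1
    refine Finset.sum_congr rfl fun a _ => ?_
    rw [← Finset.mul_prod_erase Finset.univ e (Finset.mem_univ a)]
    have := he a
    field_simp
  have hd : Dense {t : ℝ | ∀ a, d a + t ≠ 0} := by
    have : {t : ℝ | ∀ a, d a + t ≠ 0} = (Set.range fun a => -d a)ᶜ := by
      ext t
      simp only [Set.mem_ofPred_eq, Set.mem_compl_iff, Set.mem_range, not_exists]
      refine forall_congr' fun a => not_congr ⟨fun h => by linarith, fun h => by linarith⟩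
    rw [this]
    exact (Set.finite_range _).countable.dense_compl ℝ
  have hF : Continuous fun t : ℝ => (Matrix.diagonal (fun a => d a + t) +
      Matrix.replicateCol Unit v * Matrix.replicateRow Unit v).det := by
    apply Continuous.matrix_det
    refine Continuous.add ?_ continuous_const
    exact Continuous.matrix_diagonal (by fun_prop)
  have hG : Continuous fun t : ℝ =>
      ∏ a, (d a + t) + ∑ a, v a ^ 2 * ∏ l ∈ Finset.univ.erase a, (d l + t) := by fun_prop
  have := congrFun (hF.ext_on hd hG fun t ht => key _ ht) 0
  simpa using this

/-- Hessian-type minors of a product of functions of one variable: `f`, `f1`, `f2` stand for the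
values of the factors and of their first and second derivatives. -/
theorem det_hessian_of_factors {r : ℕ} (hr : 1 < r) (G : ℝ) (f f1 f2 : Fin r → ℝ)
    (h0 : ∀ a, f a = 0 → f1 a = 0) :
    (Matrix.of fun a b : Fin r => if a = b then f2 a * (G * ∏ i ∈ Finset.univ.erase a, f i)
      else f1 a * f1 b * (G * ∏ i ∈ (Finset.univ.erase a).erase b, f i)).det =
    G ^ r * (∏ a, (f a ^ (r - 1) * f2 a - f a ^ (r - 2) * f1 a ^ 2) +
      ∑ a, f a ^ (r - 2) * f1 a ^ 2 *
        ∏ l ∈ Finset.univ.erase a, (f l ^ (r - 1) * f2 l - f l ^ (r - 2) * f1 l ^ 2)) := by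
  have hr1 : r - 1 = (r - 2) + 1 := by omega
  by_cases hf : ∀ a, f a ≠ 0
  · have hP : ∀ a, ∏ i ∈ Finset.univ.erase a, f i = (∏ i, f i) / f a := fun a => by
      rw [eq_div_iff (hf a), Finset.prod_erase_mul _ _ (Finset.mem_univ a)]
    have hPP : ∀ a b, a ≠ b →
        ∏ i ∈ (Finset.univ.erase a).erase b, f i = (∏ i, f i) / (f a * f b) := fun a b hab => by
      rw [eq_div_iff (mul_ne_zero (hf a) (hf b)), mul_comm (f a), ← mul_assoc,
        Finset.prod_erase_mul _ _ (Finset.mem_erase.2 ⟨hab.symm, Finset.mem_univ b⟩),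
        Finset.prod_erase_mul _ _ (Finset.mem_univ a)]
    have hM : (Matrix.of fun a b : Fin r =>
        if a = b then f2 a * (G * ∏ i ∈ Finset.univ.erase a, f i)
        else f1 a * f1 b * (G * ∏ i ∈ (Finset.univ.erase a).erase b, f i)) =
        (G * ∏ i, f i) • (Matrix.diagonal (fun a => f2 a / f a - (f1 a / f a) ^ 2) +
          Matrix.replicateCol Unit (fun a => f1 a / f a) *
            Matrix.replicateRow Unit (fun a => f1 a / f a)) := by
      ext a b
      simp only [Matrix.of_apply, Matrix.smul_apply, Matrix.add_apply, Matrix.mul_apply,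
        Finset.univ_unique, Matrix.replicateCol_apply, Matrix.replicateRow_apply,
        Finset.sum_singleton, smul_eq_mul]
      split_ifs with hab
      · subst hab
        rw [Matrix.diagonal_apply_eq, hP]
        ring
      · rw [Matrix.diagonal_apply_ne _ hab, hPP a b hab]
        have := hf a
        have := hf b
        field_simp
        ring
    have e1 : ∀ a, f a ^ (r - 1) * f2 a - f a ^ (r - 2) * f1 a ^ 2 =
        f a ^ r * (f2 a / f a - (f1 a / f a) ^ 2) := fun a => by
      have hr2 : r = (r - 2) + 2 := by omega
      have h := hf a
      have : f a ^ r = f a ^ (r - 2) * f a ^ 2 := by rw [← pow_add, ← hr2]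
      rw [this, hr1, pow_succ]
      field_simp
    have e2 : ∀ a, f a ^ (r - 2) * f1 a ^ 2 = f a ^ r * (f1 a / f a) ^ 2 := fun a => by
      have hr2 : r = (r - 2) + 2 := by omega
      have h := hf a
      have : f a ^ r = f a ^ (r - 2) * f a ^ 2 := by rw [← pow_add, ← hr2]
      rw [this]
      field_simp
    rw [hM, Matrix.det_smul, det_diagonal_add_rankOne, Fintype.card_fin, mul_pow, mul_assoc]
    congr 1
    simp_rw [e1, Finset.prod_mul_distrib]
    rw [mul_add, Finset.prod_pow]
    congr 1
    rw [Finset.mul_sum]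
    refine Finset.sum_congr rfl fun a _ => ?_
    rw [e2, ← Finset.prod_pow, ← Finset.mul_prod_erase Finset.univ (fun i => f i ^ r)
      (Finset.mem_univ a)]
    ring
  · push Not at hf
    obtain ⟨i, hi⟩ := hf
    have hi1 := h0 i hi
    have : Nontrivial (Fin r) := Fin.nontrivial_iff_two_le.2 hr
    obtain ⟨j, hji⟩ := exists_ne i
    have hrow : ∀ b, (Matrix.of fun a b : Fin r =>
        if a = b then f2 a * (G * ∏ i ∈ Finset.univ.erase a, f i)
        else f1 a * f1 b * (G * ∏ i ∈ (Finset.univ.erase a).erase b, f i)) j b = 0 := by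
      intro b
      simp only [Matrix.of_apply]
      split_ifs with hab
      · rw [Finset.prod_eq_zero (Finset.mem_erase.2 ⟨hji.symm, Finset.mem_univ i⟩) hi]
        ring
      · by_cases hb : b = i
        · subst hb; rw [hi1]; ring
        · rw [Finset.prod_eq_zero (Finset.mem_erase.2 ⟨Ne.symm hb,
            Finset.mem_erase.2 ⟨hji.symm, Finset.mem_univ i⟩⟩) hi]
          ring
    rw [Matrix.det_eq_zero_of_row_eq_zero j hrow]
    have hz : f i ^ (r - 1) * f2 i - f i ^ (r - 2) * f1 i ^ 2 = 0 := by
      rw [hi, hi1, zero_pow (by omega)]; ring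
    rw [Finset.prod_eq_zero (Finset.mem_univ i) hz, Finset.sum_eq_zero, add_zero, mul_zero]
    intro a _
    by_cases ha : a = i
    · subst ha; rw [hi1]; ring
    · rw [Finset.prod_eq_zero (Finset.mem_erase.2 ⟨Ne.symm ha, Finset.mem_univ i⟩) hz, mul_zero]

theorem eval_det_X_smul_add {r : ℕ} (A B : Matrix (Fin r) (Fin r) ℂ) (z : ℂ) :
    ((Polynomial.X (R := ℂ) • B.map Polynomial.C + A.map Polynomial.C).det).eval z =
      (A + z • B).det := by
  rw [← Polynomial.coe_evalRingHom, RingHom.map_det]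
  congr 1
  ext a b
  simp [add_comm (A a b)]
  ring

/-- Averaging over the `r`-th roots of unity kills the mixed terms of the determinant. -/
theorem sum_det_add_rootOfUnity {r : ℕ} (hr : r ≠ 0) {ζ : ℂ} (hζ : IsPrimitiveRoot ζ r)
    (A B : Matrix (Fin r) (Fin r) ℂ) :
    ∑ k ∈ Finset.range r, (A + ζ ^ k • B).det = r * (A.det + B.det) := by
  set P := (Polynomial.X (R := ℂ) • B.map Polynomial.C + A.map Polynomial.C).det with hP
  have hdeg : P.natDegree < r + 1 := by
    have := Polynomial.natDegree_det_X_add_C_le B A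
    rw [Fintype.card_fin, ← hP] at this
    omega
  have h0 : P.coeff 0 = A.det := Polynomial.coeff_det_X_add_C_zero B A
  have h1 : P.coeff r = B.det := by
    have := Polynomial.coeff_det_X_add_C_card B A
    rwa [Fintype.card_fin] at this
  simp_rw [← eval_det_X_smul_add, ← hP, Polynomial.eval_eq_sum_range' hdeg]
  rw [Finset.sum_comm]
  simp_rw [← Finset.mul_sum, ← pow_mul]
  have hs : ∀ i ∈ Finset.range (r + 1), i ≠ 0 → i ≠ r →
      ∑ k ∈ Finset.range r, ζ ^ (k * i) = 0 := by
    intro i hi h0 hr'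
    have hne : ζ ^ i ≠ 1 := fun h => by
      have := Nat.le_of_dvd (Nat.pos_of_ne_zero h0) (hζ.dvd_of_pow_eq_one i h)
      have := Finset.mem_range.1 hi
      omega
    have := mul_neg_geom_sum (ζ ^ i) r
    rw [← pow_mul, mul_comm i r, pow_mul, hζ.pow_eq_one, one_pow, sub_self] at this
    have h2 := (mul_eq_zero.1 this).resolve_left (sub_ne_zero.2 hne.symm)
    simpa [← pow_mul, mul_comm] using h2
  rw [Finset.sum_range_succ, Finset.sum_eq_single_of_mem 0 (Finset.mem_range.2 (by omega))]
  · have : ∀ k, ζ ^ (k * r) = 1 := fun k => by rw [mul_comm, pow_mul, hζ.pow_eq_one, one_pow]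
    simp [this, h0, h1]
    ring
  · intro i hi h0
    have := Finset.mem_range.1 hi
    rw [hs i (Finset.mem_range.2 (by omega)) h0 (by omega), mul_zero]

theorem det_add_smul_eq_sum_lagrange {r : ℕ} (A B : Matrix (Fin r) (Fin r) ℂ) (z : ℂ) :
    (A + z • B).det = ∑ i ∈ Finset.range (r + 1),
      (Lagrange.basis (Finset.range (r + 1)) (fun i : ℕ => (i : ℂ)) i).eval z *
        (A + (i : ℂ) • B).det := by
  set P := (Polynomial.X (R := ℂ) • B.map Polynomial.C + A.map Polynomial.C).det with hP
  have hdeg : P.degree < (Finset.range (r + 1)).card := by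
    have := Polynomial.natDegree_det_X_add_C_le B A
    rw [Fintype.card_fin, ← hP] at this
    rw [Finset.card_range]
    exact lt_of_le_of_lt Polynomial.degree_le_natDegree (by exact_mod_cast Nat.lt_succ_of_le this)
  have := Lagrange.eq_interpolate (v := fun i : ℕ => (i : ℂ))
    (Nat.cast_injective.injOn) hdeg
  rw [← eval_det_X_smul_add, ← hP]
  conv_lhs => rw [this]
  rw [Lagrange.interpolate_apply, Polynomial.eval_finsetSum]
  refine Finset.sum_congr rfl fun i _ => ?_
  rw [Polynomial.eval_mul, Polynomial.eval_C, mul_comm, ← eval_det_X_smul_add, ← hP]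

theorem integrable_det_mul {X : Type*} [TopologicalSpace X] [MeasurableSpace X]
    [OpensMeasurableSpace X] {μ : Measure X} [IsFiniteMeasureOnCompacts μ] {r : ℕ}
    {A : X → Matrix (Fin r) (Fin r) ℂ} (hA : Continuous A) {ψ : X → ℝ} (hψ : Continuous ψ)
    (hψc : HasCompactSupport ψ) : Integrable (fun x => (A x).det * (ψ x : ℂ)) μ := by
  have : HasCompactSupport fun x => (ψ x : ℂ) := hψc.comp_left (g := Complex.ofReal) rfl
  exact (hA.matrix_det.mul (Complex.continuous_ofReal.comp hψ)).integrable_of_hasCompactSupport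
    this.mul_left

theorem exists_unimodular_le_integral_det {X : Type*} [TopologicalSpace X] [MeasurableSpace X]
    [OpensMeasurableSpace X] (μ : Measure X) [IsFiniteMeasureOnCompacts μ] {r : ℕ} (hr : r ≠ 0)
    {H : ℕ → X → Matrix (Fin r) (Fin r) ℝ} (hH : ∀ j, Continuous (H j)) {ψ : X → ℝ}
    (hψ : Continuous ψ) (hψc : HasCompactSupport ψ) (n : ℕ) :
    ∃ c : ℕ → ℂ, (∀ j, ‖c j‖ = 1) ∧ ∑ j ∈ Finset.range n, ∫ x, (H j x).det * ψ x ∂μ ≤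
      (∫ x, (∑ j ∈ Finset.range n, c j • (H j x).map Complex.ofReal).det * (ψ x : ℂ) ∂μ).re := by
  have hHc : ∀ j, Continuous fun x => (H j x).map Complex.ofReal := fun j =>
    (hH j).matrix_map Complex.continuous_ofReal
  induction n with
  | zero =>
    have : Nonempty (Fin r) := ⟨⟨0, Nat.pos_of_ne_zero hr⟩⟩
    exact ⟨fun _ => 1, by simp, by simp⟩
  | succ n ih =>
    obtain ⟨c, hc, hle⟩ := ih
    set A : X → Matrix (Fin r) (Fin r) ℂ := fun x =>
      ∑ j ∈ Finset.range n, c j • (H j x).map Complex.ofReal with hA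
    set B : X → Matrix (Fin r) (Fin r) ℂ := fun x => (H n x).map Complex.ofReal with hB
    have hAc : Continuous A := continuous_finsetSum _ fun j _ => (hHc j).const_smul (c j)
    have hBc : Continuous B := hHc n
    have hζ := Complex.isPrimitiveRoot_exp r hr
    set ζ := Complex.exp (2 * ↑π * Complex.I / ↑r)
    have hint : ∀ k : ℕ, Integrable (fun x => (A x + ζ ^ k • B x).det * (ψ x : ℂ)) μ := fun k =>
      integrable_det_mul (hAc.add (hBc.const_smul (ζ ^ k))) hψ hψc
    have hsum : ∑ k ∈ Finset.range r, ∫ x, (A x + ζ ^ k • B x).det * (ψ x : ℂ) ∂μ =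
        r * (∫ x, (A x).det * (ψ x : ℂ) ∂μ + ∫ x, (B x).det * (ψ x : ℂ) ∂μ) := by
      have hadd := integral_add (integrable_det_mul hAc hψ hψc (μ := μ))
        (integrable_det_mul hBc hψ hψc)
      have hsum := integral_finsetSum (Finset.range r) fun k _ => hint k
      rw [← hadd, ← hsum, ← integral_const_mul]
      refine integral_congr_ae (Eventually.of_forall fun x => ?_)
      change ∑ k ∈ Finset.range r, (A x + ζ ^ k • B x).det * (ψ x : ℂ) =
        r * ((A x).det * (ψ x : ℂ) + (B x).det * (ψ x : ℂ))
      rw [← Finset.sum_mul, sum_det_add_rootOfUnity hr hζ]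
      ring
    have hBre : (∫ x, (B x).det * (ψ x : ℂ) ∂μ) = ((∫ x, (H n x).det * ψ x ∂μ : ℝ) : ℂ) := by
      rw [← integral_complex_ofReal]
      refine integral_congr_ae (Eventually.of_forall fun x => ?_)
      simp only [hB, Complex.ofReal_mul]
      rw [← Complex.ofRealHom_eq_coe ((H n x).det), RingHom.map_det]
      rfl
    have hex : ∃ k ∈ Finset.range r, (∫ x, (A x).det * (ψ x : ℂ) ∂μ).re +
        ∫ x, (H n x).det * ψ x ∂μ ≤ (∫ x, (A x + ζ ^ k • B x).det * (ψ x : ℂ) ∂μ).re := by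
      apply Finset.exists_le_of_sum_le (Finset.nonempty_range_iff.2 hr)
      rw [← Complex.re_sum, hsum, hBre]
      simp [mul_add]
    obtain ⟨k, -, hk⟩ := hex
    refine ⟨Function.update c n (ζ ^ k), fun j => ?_, ?_⟩
    · by_cases hj : j = n
      · subst hj
        rw [Function.update_self, norm_pow, hζ.norm'_eq_one hr, one_pow]
      · rw [Function.update_of_ne hj, hc]
    · rw [Finset.sum_range_succ]
      refine (add_le_add_left hle _).trans (hk.trans_eq ?_)
      congr 2
      ext x
      rw [Finset.sum_range_succ, Function.update_self]
      congr 3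
      refine Finset.sum_congr rfl fun j hj => ?_
      rw [Function.update_of_ne (Finset.mem_range.1 hj).ne]

/-- For bounded real coefficients, the integral of the determinant of a linear combination can be
made at least a fixed fraction of the sum of the integrals of the individual determinants. -/
theorem exists_coeff_le_abs_integral_det {r : ℕ} (hr : r ≠ 0) :
    ∃ κ : ℝ, 0 < κ ∧ ∀ {X : Type} [TopologicalSpace X] [MeasurableSpace X]
    [OpensMeasurableSpace X] (μ : Measure X) [IsFiniteMeasureOnCompacts μ]
    {H : ℕ → X → Matrix (Fin r) (Fin r) ℝ} (_ : ∀ j, Continuous (H j)) {ψ : X → ℝ}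
    (_ : Continuous ψ) (_ : HasCompactSupport ψ) (n : ℕ),
    ∃ c : ℕ → ℝ, (∀ j, |c j| ≤ 1 + r) ∧ ∑ j ∈ Finset.range n, ∫ x, (H j x).det * ψ x ∂μ ≤
      κ * |∫ x, (∑ j ∈ Finset.range n, c j • H j x).det * ψ x ∂μ| := by
  set ℓ : ℕ → ℂ := fun i => (Lagrange.basis (Finset.range (r + 1)) (fun i : ℕ => (i : ℂ)) i).eval
    Complex.I with hℓ
  refine ⟨∑ i ∈ Finset.range (r + 1), ‖ℓ i‖ + 1, by positivity, ?_⟩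
  intro X _ _ _ μ _ H hH ψ hψ hψc n
  obtain ⟨c, hc, hle⟩ := exists_unimodular_le_integral_det μ hr hH hψ hψc n
  set q : ℕ → ℝ := fun i =>
    ∫ x, (∑ j ∈ Finset.range n, ((c j).re + i * (c j).im) • H j x).det * ψ x ∂μ with hq
  have hHc : ∀ j, Continuous fun x => (H j x).map Complex.ofReal := fun j =>
    (hH j).matrix_map Complex.continuous_ofReal
  set A : X → Matrix (Fin r) (Fin r) ℂ := fun x =>
    ∑ j ∈ Finset.range n, ((c j).re : ℂ) • (H j x).map Complex.ofReal with hA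
  set B : X → Matrix (Fin r) (Fin r) ℂ := fun x =>
    ∑ j ∈ Finset.range n, ((c j).im : ℂ) • (H j x).map Complex.ofReal with hB
  have hAc : Continuous A := continuous_finsetSum _ fun j _ => (hHc j).const_smul ((c j).re : ℂ)
  have hBc : Continuous B := continuous_finsetSum _ fun j _ => (hHc j).const_smul ((c j).im : ℂ)
  have hqA : ∀ i : ℕ, ∫ x, (A x + (i : ℂ) • B x).det * (ψ x : ℂ) ∂μ = (q i : ℂ) := by
    intro i
    rw [hq, ← integral_complex_ofReal]
    refine integral_congr_ae (Eventually.of_forall fun x => ?_)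
    simp only [Complex.ofReal_mul]
    rw [← Complex.ofRealHom_eq_coe (Matrix.det _), RingHom.map_det]
    congr 2
    ext a b
    simp only [hA, hB, Matrix.add_apply, Matrix.smul_apply, Matrix.sum_apply, Matrix.map_apply,
      smul_eq_mul, RingHom.mapMatrix_apply, Complex.ofRealHom_eq_coe, Complex.ofReal_sum,
      Complex.ofReal_mul, Complex.ofReal_add, Complex.ofReal_natCast, Finset.mul_sum]
    rw [← Finset.sum_add_distrib]
    exact Finset.sum_congr rfl fun j _ => by ring
  have hQ : ∫ x, (∑ j ∈ Finset.range n, c j • (H j x).map Complex.ofReal).det * (ψ x : ℂ) ∂μ =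
      ∑ i ∈ Finset.range (r + 1), ℓ i * (q i : ℂ) := by
    simp_rw [← hqA, ← integral_const_mul]
    have hsum := integral_finsetSum (μ := μ) (Finset.range (r + 1)) fun i _ =>
      (integrable_det_mul (hAc.add (hBc.const_smul (i : ℂ))) hψ hψc).const_mul (ℓ i)
    refine Eq.trans ?_ hsum
    refine integral_congr_ae (Eventually.of_forall fun x => ?_)
    have : ∑ j ∈ Finset.range n, c j • (H j x).map Complex.ofReal = A x + Complex.I • B x := by
      simp only [hA, hB, Finset.smul_sum, ← Finset.sum_add_distrib, smul_smul, ← add_smul]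
      refine Finset.sum_congr rfl fun j _ => ?_
      congr 1
      rw [mul_comm, Complex.re_add_im]
    simp only [this, Pi.add_apply, Pi.smul_apply]
    rw [det_add_smul_eq_sum_lagrange, Finset.sum_mul]
    exact Finset.sum_congr rfl fun i _ => by rw [mul_assoc]
  obtain ⟨i₀, hi₀, hmax⟩ := Finset.exists_max_image (Finset.range (r + 1)) (fun i => |q i|)
    ⟨0, by simp⟩
  refine ⟨fun j => (c j).re + i₀ * (c j).im, fun j => ?_, hle.trans ?_⟩
  · have h1 := (Complex.abs_re_le_norm (c j)).trans_eq (hc j)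
    have h2 := (Complex.abs_im_le_norm (c j)).trans_eq (hc j)
    have h3 : (i₀ : ℝ) ≤ r := by exact_mod_cast Nat.lt_succ_iff.1 (Finset.mem_range.1 hi₀)
    calc |(c j).re + i₀ * (c j).im| ≤ |(c j).re| + |(i₀ : ℝ) * (c j).im| := abs_add_le _ _
      _ = |(c j).re| + i₀ * |(c j).im| := by rw [abs_mul, Nat.abs_cast]
      _ ≤ 1 + r * 1 := by gcongr
      _ = 1 + r := by ring
  · rw [hQ]
    refine (Complex.re_le_norm _).trans ((norm_sum_le _ _).trans ?_)
    change _ ≤ _ * |q i₀|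
    rw [add_mul, Finset.sum_mul]
    refine le_add_of_le_of_nonneg (Finset.sum_le_sum fun i hi => ?_) (by positivity)
    rw [norm_mul, Complex.norm_real, Real.norm_eq_abs]
    exact mul_le_mul_of_nonneg_left (hmax i hi) (norm_nonneg _)

/-- The tensor product `x ↦ ∏ i, φ i (x i)` of functions of one variable. -/
def tensorFn {N : ℕ} (φ : Fin N → ℝ → ℝ) (x : Euc N) : ℝ := ∏ i, φ i (x i)

theorem contDiff_tensorFn {N : ℕ} {n : WithTop ℕ∞} {φ : Fin N → ℝ → ℝ}
    (hφ : ∀ i, ContDiff ℝ n (φ i)) : ContDiff ℝ n (tensorFn φ) := by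
  unfold tensorFn
  exact contDiff_prod fun i _ => (hφ i).comp (by fun_prop)

theorem pderiv'_tensorFn {N : ℕ} {φ : Fin N → ℝ → ℝ} (hφ : ∀ i, Differentiable ℝ (φ i))
    (a : Fin N) : pderiv' a (tensorFn φ) = tensorFn (Function.update φ a (deriv (φ a))) := by
  ext x
  have h : ∀ i ∈ Finset.univ, HasFDerivAt (fun y : Euc N => φ i (y i))
      (deriv (φ i) (x i) • EuclideanSpace.proj (𝕜 := ℝ) i) x := fun i _ =>
    ((hφ i) (x i)).hasDerivAt.comp_hasFDerivAt x (EuclideanSpace.proj (𝕜 := ℝ) i).hasFDerivAt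
  have := (HasFDerivAt.finsetProd h).fderiv
  unfold pderiv'
  change fderiv ℝ (fun y : Euc N => ∏ i, φ i (y i)) x _ = _
  have single : ∀ i, (EuclideanSpace.proj (𝕜 := ℝ) i) (EuclideanSpace.single a (1 : ℝ)) =
      if i = a then 1 else 0 := fun i => PiLp.single_apply 2 ℝ a 1 i
  rw [this, sum_apply, Finset.sum_eq_single a]
  · simp only [smul_apply, smul_eq_mul, single, tensorFn]
    rw [← Finset.prod_erase_mul Finset.univ _ (Finset.mem_univ a)]
    simp only [Function.update_self, if_true, mul_one]
    congr 1
    exact Finset.prod_congr rfl fun i hi => by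
      rw [Function.update_of_ne (Finset.ne_of_mem_erase hi)]
  · intro i _ hi
    simp [hi]
  · simp

theorem pderiv'_pderiv'_tensorFn {N : ℕ} {φ : Fin N → ℝ → ℝ} (hφ : ∀ i, ContDiff ℝ 2 (φ i))
    (a b : Fin N) (x : Euc N) : pderiv' a (pderiv' b (tensorFn φ)) x =
      if a = b then deriv (deriv (φ a)) (x a) * ∏ i ∈ Finset.univ.erase a, φ i (x i)
      else deriv (φ a) (x a) * deriv (φ b) (x b) *
        ∏ i ∈ (Finset.univ.erase a).erase b, φ i (x i) := by
  have h1 : ∀ i, Differentiable ℝ (φ i) := fun i => (hφ i).differentiable two_ne_zero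
  have h2 : ∀ i, Differentiable ℝ (deriv (φ i)) := fun i =>
    ((contDiff_succ_iff_deriv (n := 1)).1 (hφ i)).2.2.differentiable one_ne_zero
  rw [pderiv'_tensorFn h1, pderiv'_tensorFn]
  · simp only [tensorFn]
    rw [← Finset.mul_prod_erase Finset.univ _ (Finset.mem_univ a)]
    simp only [Function.update_self]
    split_ifs with hab
    · subst hab
      simp only [Function.update_self]
      congr 1
      exact Finset.prod_congr rfl fun i hi => by
        rw [Function.update_of_ne (Finset.ne_of_mem_erase hi),
          Function.update_of_ne (Finset.ne_of_mem_erase hi)]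
    · rw [Function.update_of_ne hab, ← Finset.mul_prod_erase (Finset.univ.erase a) _
        (Finset.mem_erase.2 ⟨Ne.symm hab, Finset.mem_univ b⟩),
        Function.update_of_ne (Ne.symm hab), Function.update_self, mul_assoc]
      congr 2
      exact Finset.prod_congr rfl fun i hi => by
        rw [Function.update_of_ne (Finset.ne_of_mem_erase (Finset.mem_of_mem_erase hi)),
          Function.update_of_ne (Finset.ne_of_mem_erase hi)]
  · intro i
    by_cases hi : i = b
    · subst hi; rw [Function.update_self]; exact h2 i
    · rw [Function.update_of_ne hi]; exact h1 i

theorem prod_castLE_mul_prod_filter {N r : ℕ} (h : r ≤ N) (F : Fin N → ℝ) :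
    (∏ a : Fin r, F (Fin.castLE h a)) * ∏ i ∈ Finset.univ.filter (fun i : Fin N => ¬ i.val < r), F i
      = ∏ i, F i := by
  rw [← Finset.prod_filter_mul_prod_filter_not Finset.univ (fun i : Fin N => i.val < r)]
  congr 1
  refine Finset.prod_nbij (Fin.castLE h) (by simp) (fun a _ b _ hab => Fin.castLE_injective h hab)
    ?_ (by simp)
  intro i hi
  exact ⟨⟨i.val, by simpa using hi⟩, by simp, by ext; simp⟩

theorem prod_erase_castLE {N r : ℕ} (h : r ≤ N) (F : Fin N → ℝ) (a : Fin r) :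
    ∏ i ∈ Finset.univ.erase (Fin.castLE h a), F i =
      (∏ i ∈ Finset.univ.filter (fun i : Fin N => ¬ i.val < r), F i) *
        ∏ b ∈ Finset.univ.erase a, F (Fin.castLE h b) := by
  have e1 : ∏ i ∈ Finset.univ.erase (Fin.castLE h a), F i =
      ∏ i, if i = Fin.castLE h a then 1 else F i := by
    rw [← Finset.mul_prod_erase Finset.univ _ (Finset.mem_univ (Fin.castLE h a)), if_pos rfl,
      one_mul]
    exact Finset.prod_congr rfl fun i hi => by rw [if_neg (Finset.ne_of_mem_erase hi)]
  rw [e1, ← prod_castLE_mul_prod_filter h, mul_comm]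
  congr 1
  · refine Finset.prod_congr rfl fun i hi => if_neg ?_
    rintro rfl
    simp at hi
    omega
  · rw [← Finset.mul_prod_erase Finset.univ _ (Finset.mem_univ a), if_pos rfl, one_mul]
    refine Finset.prod_congr rfl fun i hi => if_neg fun h' => ?_
    exact Finset.ne_of_mem_erase hi (Fin.castLE_injective h h')

theorem prod_erase_erase_castLE {N r : ℕ} (h : r ≤ N) (F : Fin N → ℝ) {a b : Fin r} (hab : a ≠ b) :
    ∏ i ∈ (Finset.univ.erase (Fin.castLE h a)).erase (Fin.castLE h b), F i =
      (∏ i ∈ Finset.univ.filter (fun i : Fin N => ¬ i.val < r), F i) *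
        ∏ c ∈ (Finset.univ.erase a).erase b, F (Fin.castLE h c) := by
  have hab' : Fin.castLE h b ≠ Fin.castLE h a := fun h' => hab (Fin.castLE_injective h h').symm
  have e1 : ∏ i ∈ (Finset.univ.erase (Fin.castLE h a)).erase (Fin.castLE h b), F i =
      ∏ i ∈ Finset.univ.erase (Fin.castLE h a), if i = Fin.castLE h b then 1 else F i := by
    rw [← Finset.mul_prod_erase _ _ (Finset.mem_erase.2 ⟨hab', Finset.mem_univ (Fin.castLE h b)⟩),
      if_pos rfl, one_mul]
    exact Finset.prod_congr rfl fun i hi => by rw [if_neg (Finset.ne_of_mem_erase hi)]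
  rw [e1, prod_erase_castLE h]
  congr 1
  · refine Finset.prod_congr rfl fun i hi => if_neg ?_
    rintro rfl
    simp at hi
    omega
  · rw [← Finset.mul_prod_erase _ _ (Finset.mem_erase.2 ⟨hab.symm, Finset.mem_univ b⟩),
      if_pos rfl, one_mul]
    refine Finset.prod_congr rfl fun i hi => if_neg fun h' => ?_
    exact Finset.ne_of_mem_erase hi (Fin.castLE_injective h h')

theorem integral_tensorFn {N : ℕ} (φ : Fin N → ℝ → ℝ) :
    ∫ x, tensorFn φ x = ∏ i, ∫ t, φ i t := by
  rw [← integral_fintype_prod_volume_eq_prod,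
    ← (PiLp.volume_preserving_toLp (Fin N)).integral_comp
      (MeasurableEquiv.toLp 2 (Fin N → ℝ)).measurableEmbedding]
  rfl

/-- The `r × r` leading principal minor of the Hessian. -/
def hessMinor {N r : ℕ} (h : r ≤ N) (u : Euc N → ℝ) (x : Euc N) : Matrix (Fin r) (Fin r) ℝ :=
  Matrix.of fun a b : Fin r => pderiv' (Fin.castLE h a) (pderiv' (Fin.castLE h b) u) x

/-- `f ^ (r-1) f'' - f ^ (r-2) f'^2`, that is `f ^ r (log f)''`. -/
def logHess (r : ℕ) (f : ℝ → ℝ) (t : ℝ) : ℝ :=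
  f t ^ (r - 1) * deriv (deriv f) t - f t ^ (r - 2) * deriv f t ^ 2

theorem det_hessMinor_tensorFn {N r : ℕ} (h : r ≤ N) (hr : 1 < r) {f : ℝ → ℝ}
    (hf : ContDiff ℝ 2 f) (h0 : ∀ t, f t = 0 → deriv f t = 0) (x : Euc N) :
    (hessMinor h (tensorFn fun _ => f) x).det =
      ∏ i : Fin N, (if i.val < r then logHess r f (x i) else f (x i) ^ r) +
      ∑ a : Fin r, ∏ i : Fin N, (if i = Fin.castLE h a then f (x i) ^ (r - 2) * deriv f (x i) ^ 2
        else if i.val < r then logHess r f (x i) else f (x i) ^ r) := by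
  set G : ℝ := ∏ i ∈ Finset.univ.filter (fun i : Fin N => ¬ i.val < r), f (x i) with hG
  have hM : hessMinor h (tensorFn fun _ => f) x = Matrix.of fun a b : Fin r =>
      if a = b then deriv (deriv f) (x (Fin.castLE h a)) *
        (G * ∏ i ∈ Finset.univ.erase a, f (x (Fin.castLE h i)))
      else deriv f (x (Fin.castLE h a)) * deriv f (x (Fin.castLE h b)) *
        (G * ∏ i ∈ (Finset.univ.erase a).erase b, f (x (Fin.castLE h i))) := by
    ext a b
    simp only [hessMinor, Matrix.of_apply]
    rw [pderiv'_pderiv'_tensorFn fun _ => hf]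
    by_cases hab : a = b
    · subst hab
      rw [if_pos rfl, if_pos rfl, prod_erase_castLE h]
    · rw [if_neg hab, if_neg fun h' => hab (Fin.castLE_injective h h'),
        prod_erase_erase_castLE h _ hab]
  rw [hM, det_hessian_of_factors hr G (fun a => f (x (Fin.castLE h a)))
    (fun a => deriv f (x (Fin.castLE h a))) (fun a => deriv (deriv f) (x (Fin.castLE h a)))
    fun a ha => h0 _ ha, mul_add, Finset.mul_sum]
  have hrest : ∀ F : Fin N → ℝ, (∀ i : Fin N, ¬ i.val < r → F i = f (x i) ^ r) →
      ∏ i, F i = G ^ r * ∏ a : Fin r, F (Fin.castLE h a) := by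
    intro F hF
    rw [← prod_castLE_mul_prod_filter h, mul_comm, hG, ← Finset.prod_pow]
    congr 1
    exact Finset.prod_congr rfl fun i hi => hF i (by simpa using hi)
  congr 1
  · rw [hrest _ fun i hi => if_neg hi]
    congr 1
    refine Finset.prod_congr rfl fun a _ => ?_
    rw [if_pos (by simp)]
    rfl
  · refine Finset.sum_congr rfl fun a _ => ?_
    rw [hrest, ← Finset.mul_prod_erase Finset.univ _ (Finset.mem_univ a), if_pos rfl]
    · congr 2
      refine Finset.prod_congr rfl fun b hb => ?_
      rw [if_neg fun h' => Finset.ne_of_mem_erase hb (Fin.castLE_injective h h'), if_pos (by simp)]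
      rfl
    · intro i hi
      rw [if_neg, if_neg hi]
      rintro rfl
      simp at hi

theorem continuous_logHess {r : ℕ} {f : ℝ → ℝ} (hf : ContDiff ℝ 2 f) :
    Continuous (logHess r f) := by
  have h1 : Continuous (deriv f) := hf.continuous_deriv (by norm_num)
  have h2 : Continuous (deriv (deriv f)) :=
    ((contDiff_succ_iff_deriv (n := 1)).1 hf).2.2.continuous_deriv le_rfl
  unfold logHess
  have := hf.continuous
  fun_prop

theorem integral_logHess_mul {r : ℕ} (hr : 1 < r) {f : ℝ → ℝ} (hf : ContDiff ℝ 2 f)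
    (hfc : HasCompactSupport f) {w w' w'' : ℝ → ℝ} (hw : ∀ t, HasDerivAt w (w' t) t)
    (hw' : ∀ t, HasDerivAt w' (w'' t) t) (hw'' : Continuous w'') :
    ∫ t, logHess r f t * w t =
      (r : ℝ)⁻¹ * (∫ t, f t ^ r * w'' t) - r * ∫ t, f t ^ (r - 2) * deriv f t ^ 2 * w t := by
  obtain ⟨q, rfl⟩ : ∃ q, r = q + 2 := ⟨r - 2, by omega⟩
  have cf := hf.continuous
  have c1 : Continuous (deriv f) := hf.continuous_deriv (by norm_num)
  have c2 : Continuous (deriv (deriv f)) :=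
    ((contDiff_succ_iff_deriv (n := 1)).1 hf).2.2.continuous_deriv le_rfl
  have d1 : ∀ t, HasDerivAt f (deriv f t) t := fun t =>
    (hf.differentiable two_ne_zero t).hasDerivAt
  have d2 : ∀ t, HasDerivAt (deriv f) (deriv (deriv f) t) t := fun t =>
    (((contDiff_succ_iff_deriv (n := 1)).1 hf).2.2.differentiable one_ne_zero t).hasDerivAt
  have cw : Continuous w := continuous_iff_continuousAt.2 fun t => (hw t).continuousAt
  have cw' : Continuous w' := continuous_iff_continuousAt.2 fun t => (hw' t).continuousAt
  have hr0 : ((q + 2 : ℕ) : ℝ) ≠ 0 := by positivity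
  have zf : ∀ t, t ∉ tsupport f → f t = 0 := fun t ht => image_eq_zero_of_notMem_tsupport ht
  have zd : ∀ t, t ∉ tsupport f → deriv f t = 0 := fun t ht =>
    image_eq_zero_of_notMem_tsupport fun h => ht (tsupport_deriv_subset h)
  have intg : ∀ g : ℝ → ℝ, Continuous g → (∀ t, t ∉ tsupport f → g t = 0) → Integrable g :=
    fun g hg h0 => hg.integrable_of_hasCompactSupport (HasCompactSupport.intro hfc h0)
  have hD : ∀ t, HasDerivAt
      (fun t => f t ^ (q + 1) * deriv f t * w t - ((q + 2 : ℕ) : ℝ)⁻¹ * (f t ^ (q + 2) * w' t))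
      (logHess (q + 2) f t * w t - (((q + 2 : ℕ) : ℝ)⁻¹ * (f t ^ (q + 2) * w'' t) -
        (q + 2 : ℕ) * (f t ^ q * deriv f t ^ 2 * w t))) t := by
    intro t
    have := ((((d1 t).pow (q + 1)).mul (d2 t)).mul (hw t)).sub
      ((((d1 t).pow (q + 2)).mul (hw' t)).const_mul (((q + 2 : ℕ) : ℝ)⁻¹))
    refine this.congr_deriv ?_
    simp only [logHess, Nat.add_sub_cancel, Pi.mul_apply, Pi.pow_apply,
      show q + 2 - 1 = q + 1 by omega]
    field_simp
    push_cast
    ring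
  have i1 : Integrable fun t => logHess (q + 2) f t * w t :=
    intg _ ((continuous_logHess hf).mul cw) fun t ht => by simp [logHess, zf t ht, zd t ht]
  have i2 : Integrable fun t => f t ^ (q + 2) * w'' t :=
    intg _ (by fun_prop) fun t ht => by simp [zf t ht]
  have i3 : Integrable fun t => f t ^ q * deriv f t ^ 2 * w t :=
    intg _ (by fun_prop) fun t ht => by simp [zd t ht]
  have i4 : Integrable fun t => ((q + 2 : ℕ) : ℝ)⁻¹ * (f t ^ (q + 2) * w'' t) -
      (q + 2 : ℕ) * (f t ^ q * deriv f t ^ 2 * w t) :=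
    (i2.const_mul (((q + 2 : ℕ) : ℝ)⁻¹)).sub (i3.const_mul ((q + 2 : ℕ) : ℝ))
  have key := integral_eq_zero_of_hasDerivAt_of_integrable hD (i1.sub i4)
    (intg _ (by fun_prop) fun t ht => by simp [zf t ht])
  rw [integral_sub i1 i4, sub_eq_zero] at key
  rw [key]
  rw [integral_sub (i2.const_mul _) (i3.const_mul _), integral_const_mul, integral_const_mul,
    Nat.add_sub_cancel]

theorem integral_det_hessMinor_tensorFn {N r : ℕ} (h : r ≤ N) (hr : 1 < r) {f : ℝ → ℝ}
    (hf : ContDiff ℝ 2 f) (hfc : HasCompactSupport f) (h0 : ∀ t, f t = 0 → deriv f t = 0) :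
    ∫ x, (hessMinor h (tensorFn fun _ => f) x).det * x (Fin.castLE h ⟨0, by omega⟩) ^ 2 =
      2 / (r : ℝ) ^ 2 * (-r * ∫ t, f t ^ (r - 2) * deriv f t ^ 2) ^ (r - 1) *
        (∫ t, f t ^ r) ^ (N - r + 1) := by
  set i₀ : Fin N := Fin.castLE h ⟨0, by omega⟩ with hi₀
  have hr0 : (r : ℝ) ≠ 0 := by positivity
  have c1 : Continuous (deriv f) := hf.continuous_deriv (by norm_num)
  have cf := hf.continuous
  have cL := continuous_logHess (r := r) hf
  have zf : ∀ t, t ∉ tsupport f → f t = 0 := fun t ht => image_eq_zero_of_notMem_tsupport ht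
  have zd : ∀ t, t ∉ tsupport f → deriv f t = 0 := fun t ht =>
    image_eq_zero_of_notMem_tsupport fun h => ht (tsupport_deriv_subset h)
  let W : Fin N → ℝ → ℝ := fun i t => if i = i₀ then t ^ 2 else 1
  have cW : ∀ i, Continuous (W i) := fun i => by
    by_cases hi : i = i₀ <;> simp only [W, hi, if_true, if_false] <;> fun_prop
  have hW : ∀ x : Euc N, x i₀ ^ 2 = ∏ i, W i (x i) := fun x => by
    rw [Finset.prod_eq_single i₀] <;> simp +contextual [W]
  set K := ∫ t, f t ^ (r - 2) * deriv f t ^ 2 with hK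
  set M := ∫ t, f t ^ r with hM
  set K₂ := ∫ t, f t ^ (r - 2) * deriv f t ^ 2 * t ^ 2 with hK₂
  have hα : ∫ t, logHess r f t = - (r * K) := by
    have := integral_logHess_mul hr hf hfc (w := fun _ => 1) (w' := fun _ => 0)
      (w'' := fun _ => 0) (fun t => hasDerivAt_const t 1) (fun t => hasDerivAt_const t 0)
      continuous_const
    simpa using this
  have hA : ∫ t, logHess r f t * t ^ 2 = (r : ℝ)⁻¹ * (2 * M) - r * K₂ := by
    have := integral_logHess_mul hr hf hfc (w := fun t => t ^ 2) (w' := fun t => 2 * t)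
      (w'' := fun _ => 2) (fun t => by simpa using hasDerivAt_pow 2 t)
      (fun t => by simpa using (hasDerivAt_id t).const_mul 2) continuous_const
    rw [this, integral_mul_const, mul_comm M]
  have expand : ∀ x : Euc N, (hessMinor h (tensorFn fun _ => f) x).det * x i₀ ^ 2 =
      tensorFn (fun i t => (if i.val < r then logHess r f t else f t ^ r) * W i t) x +
      ∑ a : Fin r, tensorFn (fun i t => (if i = Fin.castLE h a then f t ^ (r - 2) * deriv f t ^ 2
        else if i.val < r then logHess r f t else f t ^ r) * W i t) x := by
    intro x
    rw [det_hessMinor_tensorFn h hr hf h0, hW, add_mul, Finset.sum_mul]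
    simp only [tensorFn, Finset.prod_mul_distrib]
  have intg : ∀ F : Fin N → ℝ → ℝ, (∀ i, Continuous (F i)) →
      (∀ i t, t ∉ tsupport f → F i t = 0) → Integrable (tensorFn F) := by
    intro F hF hz
    have hFc : Continuous (tensorFn F) := by
      unfold tensorFn
      exact continuous_finsetProd _ fun i _ => (hF i).comp (by fun_prop)
    refine hFc.integrable_of_hasCompactSupport (HasCompactSupport.intro
      (K := WithLp.toLp 2 '' Set.univ.pi fun _ => tsupport f)
      ((isCompact_univ_pi fun _ => hfc).image (PiLp.continuous_toLp 2 _)) ?_)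
    intro x hx
    by_contra hne
    refine hx ⟨fun i => x i, fun i _ => ?_, rfl⟩
    by_contra hi
    exact hne (Finset.prod_eq_zero (Finset.mem_univ i) (hz i _ hi))
  have hz : ∀ (i : Fin N) t, t ∉ tsupport f →
      (if i.val < r then logHess r f t else f t ^ r) = 0 := by
    intro i t ht
    split_ifs
    · simp [logHess, zf t ht, zd t ht, Nat.sub_ne_zero_of_lt hr]
    · simp [zf t ht]; omega
  have cz : ∀ i : Fin N, Continuous fun t => if i.val < r then logHess r f t else f t ^ r := by
    intro i
    by_cases hi : i.val < r <;> simp only [hi, if_true, if_false] <;> fun_prop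
  simp only [expand]
  have I1 : Integrable (tensorFn fun (i : Fin N) t =>
      (if i.val < r then logHess r f t else f t ^ r) * W i t) :=
    intg _ (fun i => (cz i).mul (cW i)) fun i t ht => by rw [hz i t ht, zero_mul]
  have I2 : ∀ a : Fin r, Integrable (tensorFn fun i t =>
      (if i = Fin.castLE h a then f t ^ (r - 2) * deriv f t ^ 2
        else if i.val < r then logHess r f t else f t ^ r) * W i t) := by
    intro a
    refine intg _ (fun i => Continuous.mul ?_ (cW i)) fun i t ht => ?_
    · by_cases hi : i = Fin.castLE h a
      · simp only [hi, if_true]; fun_prop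
      · simpa only [hi, if_false] using cz i
    · split_ifs with h1 h2
      · simp [zd t ht]
      · simpa [h2] using Or.inl (hz i t ht)
      · simpa [h2] using Or.inl (hz i t ht)
  rw [integral_add I1 (integrable_finsetSum _ fun a _ => I2 a),
    integral_finsetSum _ fun a _ => I2 a, integral_tensorFn]
  simp only [integral_tensorFn]
  have hc : ∏ i ∈ Finset.univ.filter (fun i : Fin N => ¬ i.val < r), M = M ^ (N - r) := by
    have := prod_castLE_mul_prod_filter h fun _ => (2 : ℝ)
    simp only [Finset.prod_const, Finset.card_univ, Fintype.card_fin] at this ⊢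
    rw [← pow_add] at this
    congr 1
    have := pow_right_injective₀ (by norm_num : (0:ℝ) < 2) (by norm_num) this
    omega
  have split : ∀ F : Fin N → ℝ, (∀ i : Fin N, ¬ i.val < r → F i = M) →
      ∏ i, F i = M ^ (N - r) * ∏ a : Fin r, F (Fin.castLE h a) := by
    intro F hF
    rw [← prod_castLE_mul_prod_filter h, mul_comm, ← hc]
    congr 1
    exact Finset.prod_congr rfl fun i hi => hF i (by simpa using hi)
  have hne : ∀ i : Fin N, ¬ i.val < r → i ≠ i₀ := by
    rintro i hi rfl
    exact hi (by simp [hi₀]; omega)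
  obtain ⟨q, rfl⟩ : ∃ q, r = q + 2 := ⟨r - 2, by omega⟩
  have zc : Fin.castLE h (0 : Fin (q + 2)) = i₀ := rfl
  have sc : ∀ a : Fin (q + 1), Fin.castLE h a.succ ≠ i₀ := fun a ha => by
    rw [← zc] at ha
    exact Fin.succ_ne_zero a (Fin.castLE_injective h ha)
  rw [split _ fun i hi => by simp [hi, W, hne i hi, hM]]
  rw [Finset.sum_congr rfl fun a _ => split _ fun i hi => by
    have : i ≠ Fin.castLE h a := by rintro rfl; simp at hi
    simp [hi, W, hne i hi, hM, this]]
  rw [← Finset.mul_sum, ← mul_add, Fin.prod_univ_succ, Fin.sum_univ_succ]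
  simp only [Fin.prod_univ_succ (n := q + 1), zc, W, sc, if_true, if_false, mul_one]
  have lt0 : i₀.val < q + 2 := by simp [hi₀]
  have lts : ∀ a : Fin (q + 1), (Fin.castLE h a.succ).val < q + 2 := fun a => by
    simp; omega
  have hprod : ∀ a : Fin (q + 1), (∏ b : Fin (q + 1), ∫ t,
      if Fin.castLE h b.succ = Fin.castLE h a.succ then f t ^ (q + 2 - 2) * deriv f t ^ 2
        else logHess (q + 2) f t) = K * (-((q + 2 : ℕ) * K)) ^ q := by
    intro a
    rw [← Finset.mul_prod_erase Finset.univ _ (Finset.mem_univ a), Finset.prod_congr rfl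
      (g := fun _ => -((q + 2 : ℕ) * K))]
    · simp [hK]
    · intro b hb
      have : Fin.castLE h b.succ ≠ Fin.castLE h a.succ := fun h' =>
        Finset.ne_of_mem_erase hb (Fin.succ_injective _ (Fin.castLE_injective h h'))
      simp only [this, if_false, hα]
  simp only [lt0, lts, if_true, fun a => (sc a).symm, if_false, hα, hA, hprod, ← hK₂,
    Finset.sum_const, Finset.prod_const, Finset.card_univ, Fintype.card_fin, nsmul_eq_mul]
  rw [show q + 2 - 1 = q + 1 by omega]
  field_simp
  push_cast
  ring

/-- A smooth bump on the line supported in `[-1/4, 1/4]`. -/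
def lineBump : ℝ → ℝ :=
  ⇑({ rIn := 1 / 8, rOut := 1 / 4, rIn_pos := by norm_num, rIn_lt_rOut := by norm_num } :
    ContDiffBump (0 : ℝ))

theorem contDiff_lineBump {n : ℕ∞} : ContDiff ℝ n lineBump := ContDiffBump.contDiff _

theorem lineBump_nonneg (t : ℝ) : 0 ≤ lineBump t := ContDiffBump.nonneg _

theorem lineBump_zero : lineBump 0 = 1 :=
  ContDiffBump.one_of_mem_closedBall _ (by simp)

theorem notMem_tsupport_lineBump {t : ℝ} (ht : 1 / 4 < |t|) : t ∉ tsupport lineBump := by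
  unfold lineBump
  rw [ContDiffBump.tsupport_eq, Metric.mem_closedBall, dist_zero_right, Real.norm_eq_abs]
  exact not_le.2 ht

theorem iteratedDeriv_lineBump_eq_zero (j : ℕ) {t : ℝ} (ht : 1 / 4 < |t|) :
    iteratedDeriv j lineBump t = 0 := by
  by_contra h
  rw [← ne_eq, ← norm_ne_zero_iff, ← norm_iteratedFDeriv_eq_norm_iteratedDeriv,
    norm_ne_zero_iff] at h
  exact notMem_tsupport_lineBump ht (support_iteratedFDeriv_subset j h)

theorem lineBump_eq_zero {t : ℝ} (ht : 1 / 4 < |t|) : lineBump t = 0 := by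
  simpa using iteratedDeriv_lineBump_eq_zero 0 ht

theorem deriv_lineBump_eq_zero {t : ℝ} (ht : 1 / 4 < |t|) : deriv lineBump t = 0 := by
  simpa using iteratedDeriv_lineBump_eq_zero 1 ht

theorem exists_abs_iteratedDeriv_lineBump_le (j : ℕ) :
    ∃ C, ∀ t, |iteratedDeriv j lineBump t| ≤ C := by
  have hc : Continuous (iteratedDeriv j lineBump) :=
    (contDiff_lineBump (n := ⊤)).continuous_iteratedDeriv j (by exact_mod_cast le_top)
  have hs : HasCompactSupport (iteratedDeriv j lineBump) :=
    HasCompactSupport.intro (isCompact_Icc (a := -(1 / 4 : ℝ)) (b := 1 / 4)) fun t ht =>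
      iteratedDeriv_lineBump_eq_zero j (by
        by_contra h
        exact ht (abs_le.1 (not_lt.1 h)))
  exact hs.exists_bound_of_continuous hc

/-- The sum of the translates of `lineBump` by `0, …, L - 1`. -/
def comb (L : ℕ) (t : ℝ) : ℝ := ∑ k ∈ Finset.range L, lineBump (t - k)

theorem exists_nat_forall_ne_lt_abs_sub (t : ℝ) : ∃ k₀ : ℕ, ∀ k : ℕ, k ≠ k₀ → 1 / 4 < |t - k| := by
  by_cases h : ∃ k₀ : ℕ, |t - k₀| ≤ 1 / 4
  · obtain ⟨k₀, h⟩ := h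
    refine ⟨k₀, fun k hk => ?_⟩
    have h1 : (1 : ℝ) ≤ |(k : ℝ) - k₀| := by
      have : (1 : ℤ) ≤ |(k : ℤ) - k₀| := Int.one_le_abs (sub_ne_zero.2 (by exact_mod_cast hk))
      exact_mod_cast this
    have h2 : |(k : ℝ) - k₀| ≤ |t - k₀| + |t - k| := by
      rw [show (k : ℝ) - k₀ = (t - k₀) - (t - k) by ring]
      exact abs_sub _ _
    linarith
  · push Not at h
    exact ⟨0, fun k _ => h k⟩

/-- At each point at most one translate contributes, so functions of the translates add up. -/
theorem apply_sum_translates {ι : Type*} {φ : ι → ℝ → ℝ} (hφ : ∀ i t, 1 / 4 < |t| → φ i t = 0)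
    {G : (ι → ℝ) → ℝ} (hG : G (fun _ => 0) = 0) (L : ℕ) (t : ℝ) :
    G (fun i => ∑ k ∈ Finset.range L, φ i (t - k)) =
      ∑ k ∈ Finset.range L, G fun i => φ i (t - k) := by
  obtain ⟨k₀, h⟩ := exists_nat_forall_ne_lt_abs_sub t
  have hs : ∀ g : ℝ → ℝ, (∀ t, 1 / 4 < |t| → g t = 0) →
      ∑ k ∈ Finset.range L, g (t - k) = if k₀ ∈ Finset.range L then g (t - k₀) else 0 := by
    intro g hg
    rw [← Finset.sum_ite_eq' (Finset.range L) k₀ fun k : ℕ => g (t - k)]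
    refine Finset.sum_congr rfl fun k _ => ?_
    split_ifs with hk
    · rfl
    · exact hg _ (h k hk)
  rw [hs (fun t => G fun i => φ i t) fun t ht => by simp only [hφ _ _ ht, hG]]
  simp only [fun i => hs (φ i) (hφ i)]
  split_ifs <;> simp [hG]

theorem contDiff_comb {n : ℕ∞} (L : ℕ) : ContDiff ℝ n (comb L) :=
  ContDiff.sum fun k _ => contDiff_lineBump.comp (by fun_prop)

theorem iteratedDeriv_comb (L j : ℕ) (t : ℝ) :
    iteratedDeriv j (comb L) t = ∑ k ∈ Finset.range L, iteratedDeriv j lineBump (t - k) := by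
  unfold comb
  have hd : ∀ k ∈ Finset.range L, ContDiffAt ℝ j (fun t => lineBump (t - (k : ℝ))) t := fun k _ =>
    ((contDiff_lineBump (n := j)).comp (contDiff_id.sub contDiff_const)).contDiffAt
  rw [iteratedDeriv_fun_sum hd]
  refine Finset.sum_congr rfl fun k _ => ?_
  rw [iteratedDeriv_comp_sub_const]

theorem deriv_comb (L : ℕ) (t : ℝ) :
    deriv (comb L) t = ∑ k ∈ Finset.range L, deriv lineBump (t - k) := by
  simpa using iteratedDeriv_comb L 1 t

theorem comb_nonneg (L : ℕ) (t : ℝ) : 0 ≤ comb L t :=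
  Finset.sum_nonneg fun _ _ => lineBump_nonneg _

theorem comb_eq_zero {L : ℕ} {t : ℝ} (ht : L < |t|) : comb L t = 0 := by
  refine Finset.sum_eq_zero fun k hk => lineBump_eq_zero ?_
  have hk' : (k : ℝ) + 1 ≤ L := by exact_mod_cast Finset.mem_range.1 hk
  have h2 : |t| - |(k : ℝ)| ≤ |t - k| := abs_sub_abs_le_abs_sub _ _
  rw [Nat.abs_cast] at h2
  linarith

theorem exists_abs_iteratedDeriv_comb_le (j : ℕ) :
    ∃ C, ∀ (L : ℕ) (t : ℝ), |iteratedDeriv j (comb L) t| ≤ C := by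
  obtain ⟨C, hC⟩ := exists_abs_iteratedDeriv_lineBump_le j
  refine ⟨C, fun L t => ?_⟩
  obtain ⟨k₀, h⟩ := exists_nat_forall_ne_lt_abs_sub t
  rw [iteratedDeriv_comb]
  by_cases hk : k₀ ∈ Finset.range L
  · rw [Finset.sum_eq_single k₀ (fun k _ hk => iteratedDeriv_lineBump_eq_zero j (h k hk))
      fun h => absurd hk h]
    exact hC _
  · rw [Finset.sum_eq_zero fun k hk' =>
      iteratedDeriv_lineBump_eq_zero j (h k (by rintro rfl; exact hk hk'))]
    simpa using (abs_nonneg _).trans (hC 0)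

theorem integral_sum_translates {g : ℝ → ℝ} (hg : Integrable g) (L : ℕ) {R : ℝ} (hR : 0 < R) :
    ∫ t, ∑ k ∈ Finset.range L, g (R * t - k) = L / R * ∫ t, g t := by
  rw [Measure.integral_comp_mul_left (fun t => ∑ k ∈ Finset.range L, g (t - k)),
    integral_finsetSum _ fun k _ => hg.comp_sub_right _]
  simp only [integral_sub_right_eq_self, Finset.sum_const, Finset.card_range, nsmul_eq_mul,
    smul_eq_mul, abs_of_pos (inv_pos.2 hR)]
  ring

/-- The product array of bumps of width `1 / R`, with `L` bumps in each direction. -/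
def gridFn (N L : ℕ) (R : ℝ) : Euc N → ℝ := tensorFn fun _ t => comb L (R * t)

theorem contDiff_comb_mul {n : ℕ∞} (L : ℕ) (R : ℝ) : ContDiff ℝ n fun t => comb L (R * t) :=
  (contDiff_comb L).comp (by fun_prop)

theorem contDiff_gridFn {n : ℕ∞} (N L : ℕ) (R : ℝ) : ContDiff ℝ n (gridFn N L R) :=
  contDiff_tensorFn fun _ => contDiff_comb_mul L R

/-- The closed cube of half side `ρ`. -/
def cube (N : ℕ) (ρ : ℝ) : Set (Euc N) := {x | ∀ i, |x i| ≤ ρ}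

theorem isClosed_cube (N : ℕ) (ρ : ℝ) : IsClosed (cube N ρ) := by
  have : cube N ρ = ⋂ i, {x : Euc N | |x i| ≤ ρ} := by ext; simp [cube]
  rw [this]
  exact isClosed_iInter fun i => isClosed_le (by fun_prop) continuous_const

theorem cube_eq_image (N : ℕ) (ρ : ℝ) :
    cube N ρ = WithLp.toLp 2 '' Set.univ.pi fun _ : Fin N => Set.Icc (-ρ) ρ := by
  ext x
  constructor
  · intro h
    exact ⟨fun i => x i, fun i _ => abs_le.1 (h i), rfl⟩
  · rintro ⟨y, hy, rfl⟩ i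
    exact abs_le.2 (hy i trivial)

theorem isCompact_cube (N : ℕ) (ρ : ℝ) : IsCompact (cube N ρ) := by
  rw [cube_eq_image]
  exact (isCompact_univ_pi fun _ => isCompact_Icc).image (PiLp.continuous_toLp 2 _)

theorem volume_cube (N : ℕ) {ρ : ℝ} (hρ : 0 ≤ ρ) :
    volume (cube N ρ) = ENNReal.ofReal ((2 * ρ) ^ N) := by
  rw [← (PiLp.volume_preserving_toLp (Fin N)).measure_preimage
    (isClosed_cube N ρ).measurableSet.nullMeasurableSet]
  have : WithLp.toLp 2 ⁻¹' cube N ρ = Set.univ.pi fun _ : Fin N => Set.Icc (-ρ) ρ := by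
    ext y
    simp [cube, abs_le, -Set.pi_univ_Icc]
  rw [this, volume_pi_pi]
  simp only [Real.volume_Icc, Finset.prod_const, Finset.card_univ, Fintype.card_fin]
  rw [← ENNReal.ofReal_pow (by linarith)]
  congr 2
  ring

theorem tsupport_gridFn_subset (N L : ℕ) {R : ℝ} (hR : 0 < R) :
    tsupport (gridFn N L R) ⊆ cube N (L / R) := by
  refine closure_minimal (fun x hx i => ?_) (isClosed_cube _ _)
  by_contra hi
  refine hx (Finset.prod_eq_zero (Finset.mem_univ i) (comb_eq_zero ?_))
  rw [not_le, div_lt_iff₀ hR] at hi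
  rwa [abs_mul, abs_of_pos hR, mul_comm]

theorem exists_norm_iteratedFDeriv_gridFn_le (N j : ℕ) : ∃ C, 0 < C ∧
    ∀ (L : ℕ) (R : ℝ), 0 < R → ∀ x, ‖iteratedFDeriv ℝ j (gridFn N L R) x‖ ≤ C * R ^ j := by
  choose B hB using exists_abs_iteratedDeriv_comb_le
  set D : ℝ := 1 + ∑ i ∈ Finset.range (j + 1), |B i| with hD
  have hD1 : 1 ≤ D := le_add_of_nonneg_right (Finset.sum_nonneg fun _ _ => abs_nonneg _)
  have hBD : ∀ i ≤ j, B i ≤ D := fun i hi => (le_abs_self _).trans <|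
    (Finset.single_le_sum (f := fun i => |B i|) (fun _ _ => abs_nonneg _)
      (Finset.mem_range.2 (Nat.lt_succ_of_le hi))).trans (by linarith)
  set C : ℝ := ∑ q ∈ (Finset.univ : Finset (Fin N)).sym j,
    ((q : Multiset (Fin N)).countPerms : ℝ) * D ^ N with hC
  have hC0 : 0 ≤ C := Finset.sum_nonneg fun _ _ => by positivity
  refine ⟨C + 1, by positivity, fun L R hR x => ?_⟩
  have hcoord : ∀ (i : Fin N) (n : ℕ), n ≤ j →
      ‖iteratedFDeriv ℝ n (fun y : Euc N => comb L (R * y i)) x‖ ≤ D * R ^ n := by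
    intro i n hn
    have h1 := (EuclideanSpace.proj (𝕜 := ℝ) i).iteratedFDeriv_comp_right
      (contDiff_comb_mul (n := n) L R) x (i := n) le_rfl
    change ‖iteratedFDeriv ℝ n ((fun t => comb L (R * t)) ∘ EuclideanSpace.proj (𝕜 := ℝ) i) x‖ ≤ _
    rw [h1]
    refine (ContinuousMultilinearMap.norm_compContinuousLinearMap_le _ _).trans ?_
    rw [norm_iteratedFDeriv_eq_norm_iteratedDeriv,
      iteratedDeriv_comp_const_mul (contDiff_comb (n := n) L), norm_mul, norm_pow,
      Real.norm_of_nonneg hR.le]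
    have h2 : ∏ _k : Fin n, ‖EuclideanSpace.proj (𝕜 := ℝ) (ι := Fin N) i‖ ≤ 1 := by
      refine Finset.prod_le_one (fun _ _ => norm_nonneg _) fun _ _ => ?_
      refine ContinuousLinearMap.opNorm_le_bound _ zero_le_one fun y => ?_
      simpa using PiLp.norm_apply_le y i
    calc _ ≤ (R ^ n * D) * 1 := by
          refine mul_le_mul (mul_le_mul_of_nonneg_left ((hB n L _).trans (hBD n hn))
            (by positivity)) h2 (Finset.prod_nonneg fun _ _ => norm_nonneg _) (by positivity)
      _ = D * R ^ n := by ring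
  have h := norm_iteratedFDeriv_prod_le (𝕜 := ℝ) (u := Finset.univ) (N := j)
    (f := fun (i : Fin N) (y : Euc N) => comb L (R * y i))
    (fun i _ => (contDiff_comb_mul (n := j) L R).comp (by fun_prop)) (x := x) (n := j) le_rfl
  refine h.trans ?_
  have : C * R ^ j ≤ (C + 1) * R ^ j := by gcongr; linarith
  refine le_trans ?_ this
  rw [hC, Finset.sum_mul]
  refine Finset.sum_le_sum fun q hq => ?_
  rw [mul_assoc]
  refine mul_le_mul_of_nonneg_left ?_ (by positivity)
  have hcount : ∀ i, (q : Multiset (Fin N)).count i ≤ j := fun i =>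
    (Multiset.count_le_card i _).trans q.2.le
  calc _ ≤ ∏ i : Fin N, D * R ^ (q : Multiset (Fin N)).count i :=
        Finset.prod_le_prod (fun _ _ => norm_nonneg _) fun i _ => hcoord i _ (hcount i)
    _ = D ^ N * R ^ j := by
        rw [Finset.prod_mul_distrib, Finset.prod_pow_eq_pow_sum,
          Finset.sum_count_of_mem_sym hq]
        simp

theorem exists_integral_det_hessMinor_gridFn {N r : ℕ} (h : r ≤ N) (hr : 1 < r) : ∃ c : ℝ, c ≠ 0 ∧
    ∀ (L : ℕ) (R : ℝ), 0 < R →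
      ∫ x, (hessMinor h (gridFn N L R) x).det * x (Fin.castLE h ⟨0, by omega⟩) ^ 2 =
        c * R ^ (2 * r - 2) * (L / R) ^ N := by
  have hr0 : (r : ℝ) ≠ 0 := by positivity
  have cφ : Continuous lineBump := (contDiff_lineBump (n := 0)).continuous
  have cφ' : Continuous (deriv lineBump) :=
    (contDiff_lineBump (n := 1)).continuous_deriv (by norm_num)
  have i1 : HasCompactSupport fun t => lineBump t ^ (r - 2) * deriv lineBump t ^ 2 :=
    HasCompactSupport.intro (isCompact_Icc (a := -(1 / 4 : ℝ)) (b := 1 / 4)) fun t ht => by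
      rw [deriv_lineBump_eq_zero (not_le.1 fun h => ht (abs_le.1 h))]; simp
  have i2 : HasCompactSupport fun t => lineBump t ^ r :=
    HasCompactSupport.intro (isCompact_Icc (a := -(1 / 4 : ℝ)) (b := 1 / 4)) fun t ht => by
      rw [lineBump_eq_zero (not_le.1 fun h => ht (abs_le.1 h))]; simp; omega
  set K := ∫ t, lineBump t ^ (r - 2) * deriv lineBump t ^ 2 with hK
  set M := ∫ t, lineBump t ^ r with hM
  have hMpos : 0 < M := (cφ.pow r).integral_pos_of_hasCompactSupport_nonneg_nonzero i2
    (fun t => pow_nonneg (lineBump_nonneg t) _) (x := 0) (by simp [lineBump_zero])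
  have hKpos : 0 < K := by
    obtain ⟨t, ht⟩ : ∃ t, lineBump t ^ (r - 2) * deriv lineBump t ^ 2 ≠ 0 := by
      by_contra! hall
      have hd : ∀ t, deriv (fun t => lineBump t ^ r) t = 0 := by
        intro t
        rw [deriv_fun_pow ((contDiff_lineBump (n := 1)).differentiable (by norm_num) t)]
        have := hall t
        obtain ⟨q, rfl⟩ : ∃ q, r = q + 2 := ⟨r - 2, by omega⟩
        rcases mul_eq_zero.1 this with h' | h'
        · simp only [Nat.add_sub_cancel] at h'
          rw [show q + 2 - 1 = q + 1 by omega, pow_succ, h']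
          ring
        · rw [pow_eq_zero_iff two_ne_zero] at h'
          rw [h', mul_zero]
      have := is_const_of_deriv_eq_zero
        (((contDiff_lineBump (n := 1)).pow r).differentiable (by norm_num)) hd 0 1
      rw [lineBump_zero, lineBump_eq_zero (t := 1) (by norm_num), one_pow,
        zero_pow (by omega)] at this
      exact one_ne_zero this
    refine Continuous.integral_pos_of_hasCompactSupport_nonneg_nonzero (by fun_prop) i1
      (fun t => mul_nonneg (pow_nonneg (lineBump_nonneg t) _) (sq_nonneg _)) ht
  refine ⟨2 / (r : ℝ) ^ 2 * (-r * K) ^ (r - 1) * M ^ (N - r + 1), ?_, fun L R hR => ?_⟩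
  · have : -(r : ℝ) * K ≠ 0 := mul_ne_zero (neg_ne_zero.2 hr0) hKpos.ne'
    positivity
  · have hf0 : ∀ t, comb L (R * t) = 0 → deriv (fun t => comb L (R * t)) t = 0 := by
      intro t ht
      refine IsLocalMin.deriv_eq_zero (Filter.Eventually.of_forall fun y => ?_)
      simp only [ht]
      exact comb_nonneg _ _
    have hfc : HasCompactSupport fun t => comb L (R * t) := by
      refine HasCompactSupport.intro (isCompact_Icc (a := -(L / R)) (b := L / R)) fun t ht => ?_
      refine comb_eq_zero ?_
      rw [abs_mul, abs_of_pos hR, mul_comm, ← div_lt_iff₀ hR]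
      exact not_le.1 fun h => ht (abs_le.1 h)
    have hd : ∀ t, deriv (fun t => comb L (R * t)) t = R * deriv (comb L) (R * t) := fun t => by
      simpa using deriv_comp_mul_left R (comb L) t
    have e1 : ∫ t, comb L (R * t) ^ (r - 2) * deriv (fun t => comb L (R * t)) t ^ 2 =
        L * R * K := by
      have : ∀ t, comb L (R * t) ^ (r - 2) * deriv (fun t => comb L (R * t)) t ^ 2 =
          R ^ 2 * ∑ k ∈ Finset.range L,
            lineBump (R * t - k) ^ (r - 2) * deriv lineBump (R * t - k) ^ 2 := by
        intro t
        have := apply_sum_translates (ι := Bool)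
          (φ := fun b => if b then lineBump else deriv lineBump)
          (fun b t ht => by cases b <;> simp [lineBump_eq_zero ht, deriv_lineBump_eq_zero ht])
          (G := fun y => y true ^ (r - 2) * y false ^ 2) (by simp) L (R * t)
        simp only [if_true, Bool.false_eq_true, if_false] at this
        rw [hd, deriv_comb, ← this, comb]
        ring
      simp only [this]
      rw [integral_const_mul, integral_sum_translates
        (g := fun t => lineBump t ^ (r - 2) * deriv lineBump t ^ 2)
        (Continuous.integrable_of_hasCompactSupport (by fun_prop) i1) L hR]
      rw [← hK]
      field_simp
    have e2 : ∫ t, comb L (R * t) ^ r = L / R * M := by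
      have : ∀ t, comb L (R * t) ^ r = ∑ k ∈ Finset.range L, lineBump (R * t - k) ^ r := by
        intro t
        exact apply_sum_translates (ι := Unit) (φ := fun _ => lineBump)
          (fun _ t ht => lineBump_eq_zero ht) (G := fun y => y () ^ r) (by simp; omega) L (R * t)
      simp only [this]
      rw [integral_sum_translates (g := fun t => lineBump t ^ r)
        ((cφ.pow r).integrable_of_hasCompactSupport i2) L hR]
    unfold gridFn
    rw [integral_det_hessMinor_tensorFn h hr (contDiff_comb_mul (n := 2) L R) hfc hf0, e1, e2]
    obtain ⟨q, rfl⟩ : ∃ q, r = q + 2 := ⟨r - 2, by omega⟩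
    obtain ⟨d, rfl⟩ : ∃ d, N = q + 2 + d := ⟨N - (q + 2), by omega⟩
    rw [show q + 2 - 1 = q + 1 by omega, show q + 2 + d - (q + 2) + 1 = d + 1 by omega,
      show 2 * (q + 2) - 2 = 2 * (q + 1) by omega]
    simp only [div_pow, mul_pow, pow_add, pow_mul]
    field_simp
    ring

theorem integrable_min_norm_rpow_div {N : ℕ} (hN : 0 < N) {p σ : ℝ} (hp : 0 < p) (h0 : 0 < σ)
    (h1 : σ < 1) :
    Integrable fun z : Euc N => min ‖z‖ 1 ^ p / ‖z‖ ^ ((N : ℝ) + σ * p) := by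
  have : Nonempty (Fin N) := ⟨⟨0, hN⟩⟩
  have hσp : 0 < σ * p := mul_pos h0 hp
  rw [integrable_fun_norm_addHaar volume (f := fun t => min t 1 ^ p / t ^ ((N : ℝ) + σ * p))]
  rw [finrank_euclideanSpace, Fintype.card_fin]
  have hpow : ∀ t : ℝ, 0 < t → t ^ (N - 1) / t ^ ((N : ℝ) + σ * p) = t ^ (-1 - σ * p) := by
    intro t ht
    rw [← Real.rpow_natCast, ← Real.rpow_sub ht, Nat.cast_sub hN]
    congr 1
    push_cast
    ring
  rw [← Set.Ioc_union_Ioi_eq_Ioi zero_le_one, integrableOn_union]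
  constructor
  · have : IntegrableOn (fun t : ℝ => t ^ ((1 - σ) * p - 1)) (Set.Ioc 0 1) := by
      rw [← intervalIntegrable_iff_integrableOn_Ioc_of_le zero_le_one]
      exact intervalIntegral.intervalIntegrable_rpow' (by nlinarith)
    refine this.congr_fun (fun t ht => ?_) measurableSet_Ioc
    simp only [smul_eq_mul, min_eq_left ht.2]
    rw [mul_div_left_comm, hpow t ht.1, ← Real.rpow_add ht.1]
    congr 1
    ring
  · refine (integrableOn_Ioi_rpow_of_lt (a := -1 - σ * p) (by linarith) one_pos).congr_fun
      (fun t ht => ?_) measurableSet_Ioi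
    have ht' : (0 : ℝ) < t := one_pos.trans ht
    simp only [smul_eq_mul, min_eq_right (le_of_lt (Set.mem_Ioi.1 ht)), Real.one_rpow]
    rw [mul_one_div, hpow t ht']

theorem exists_lintegral_min_norm_rpow_div_le {N : ℕ} (hN : 0 < N) {p σ : ℝ} (hp : 0 < p)
    (h0 : 0 < σ) (h1 : σ < 1) : ∃ C, 0 ≤ C ∧ ∀ R : ℝ, 0 < R →
      ∫⁻ z : Euc N, ENNReal.ofReal (min (R * ‖z‖) 1 ^ p / ‖z‖ ^ ((N : ℝ) + σ * p)) ≤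
        ENNReal.ofReal (C * R ^ (σ * p)) := by
  set g : Euc N → ℝ := fun z => min ‖z‖ 1 ^ p / ‖z‖ ^ ((N : ℝ) + σ * p) with hg
  have hgi : Integrable g := integrable_min_norm_rpow_div hN hp h0 h1
  have hg0 : ∀ z, 0 ≤ g z := fun z => by positivity
  refine ⟨∫ z, g z, integral_nonneg hg0, fun R hR => le_of_eq ?_⟩
  have e : ∀ z : Euc N, min (R * ‖z‖) 1 ^ p / ‖z‖ ^ ((N : ℝ) + σ * p) =
      R ^ ((N : ℝ) + σ * p) * g (R • z) := by
    intro z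
    simp only [hg, norm_smul, Real.norm_of_nonneg hR.le]
    rw [Real.mul_rpow hR.le (norm_nonneg z)]
    have : R ^ ((N : ℝ) + σ * p) ≠ 0 := (Real.rpow_pos_of_pos hR _).ne'
    field_simp
  simp only [e]
  rw [← ofReal_integral_eq_lintegral_ofReal ((hgi.comp_smul hR.ne').const_mul _)
    (Filter.Eventually.of_forall fun z => by have := hg0 (R • z); positivity),
    integral_const_mul, Measure.integral_comp_smul, finrank_euclideanSpace, Fintype.card_fin,
    abs_of_pos (by positivity), smul_eq_mul, Real.rpow_add hR, Real.rpow_natCast]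
  congr 1
  field_simp

theorem integral_le_of_lintegral_enorm_le {α : Type*} [MeasurableSpace α] {μ : Measure α}
    {f : α → ℝ} {b : ℝ} (hb : 0 ≤ b) (h : ∫⁻ x, ‖f x‖ₑ ∂μ ≤ ENNReal.ofReal b) :
    ∫ x, f x ∂μ ≤ b := by
  have h1 := (enorm_integral_le_lintegral_enorm f).trans h
  rw [← ofReal_norm, ENNReal.ofReal_le_ofReal_iff hb] at h1
  exact (le_abs_self _).trans h1

theorem integral_norm_rpow_le {N : ℕ} {F : Type*} [NormedAddCommGroup F] (Ω : Set (Euc N))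
    {p : ℝ} (hp : 0 < p) {g : Euc N → F} {S : Set (Euc N)} (hS : MeasurableSet S) {V E : ℝ}
    (hV : volume S ≤ ENNReal.ofReal V) (hV0 : 0 ≤ V) (hE : ∀ x, ‖g x‖ ≤ E)
    (hg : ∀ x, x ∉ S → g x = 0) :
    (∫ x in Ω, ‖g x‖ ^ p) ^ (1 / p) ≤ E * V ^ (1 / p) := by
  have hE0 : 0 ≤ E := (norm_nonneg _).trans (hE 0)
  have h : ∫ x in Ω, ‖g x‖ ^ p ≤ E ^ p * V := by
    refine integral_le_of_lintegral_enorm_le (by positivity) ?_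
    calc ∫⁻ x in Ω, ‖‖g x‖ ^ p‖ₑ ≤ ∫⁻ x, ‖‖g x‖ ^ p‖ₑ := setLIntegral_le_lintegral _ _
      _ ≤ ∫⁻ x, S.indicator (fun _ => ENNReal.ofReal (E ^ p)) x := by
          refine lintegral_mono fun x => ?_
          by_cases hx : x ∈ S
          · rw [Set.indicator_of_mem hx, Real.enorm_of_nonneg (by positivity)]
            exact ENNReal.ofReal_le_ofReal
              (Real.rpow_le_rpow (norm_nonneg _) (hE x) hp.le)
          · simp [hg x hx, Real.zero_rpow hp.ne']
      _ = ENNReal.ofReal (E ^ p) * volume S := by rw [lintegral_indicator_const hS]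
      _ ≤ ENNReal.ofReal (E ^ p * V) := by
          rw [ENNReal.ofReal_mul (by positivity)]
          gcongr
  calc (∫ x in Ω, ‖g x‖ ^ p) ^ (1 / p) ≤ (E ^ p * V) ^ (1 / p) :=
        Real.rpow_le_rpow (integral_nonneg fun x => by positivity) h (by positivity)
    _ = E * V ^ (1 / p) := by
        rw [Real.mul_rpow (by positivity) hV0, ← Real.rpow_mul hE0, mul_one_div_cancel hp.ne',
          Real.rpow_one]

theorem integral_integral_norm_sub_rpow_div_le {N : ℕ} {F : Type*} [NormedAddCommGroup F]
    (Ω : Set (Euc N)) {p q : ℝ} (hp : 0 < p) {g : Euc N → F} {S : Set (Euc N)}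
    (hS : MeasurableSet S) {V κ : ℝ} (hV : volume S ≤ ENNReal.ofReal V) (hV0 : 0 ≤ V)
    (hκ0 : 0 ≤ κ) {T : ℝ → ℝ} (hT : Measurable T) (hgT : ∀ x y, ‖g x - g y‖ ≤ T ‖x - y‖)
    (hg : ∀ x, x ∉ S → g x = 0)
    (hκ : ∫⁻ z : Euc N, ENNReal.ofReal (T ‖z‖ ^ p / ‖z‖ ^ q) ≤ ENNReal.ofReal κ) :
    ∫ x in Ω, ∫ y in Ω, ‖g x - g y‖ ^ p / ‖x - y‖ ^ q ≤ 2 * κ * V := by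
  set h : Euc N → ENNReal := fun z => ENNReal.ofReal (T ‖z‖ ^ p / ‖z‖ ^ q) with hh
  have hm : Measurable h := by
    refine ENNReal.measurable_ofReal.comp (Measurable.div ?_ ?_)
    · exact (hT.comp measurable_norm).pow_const p
    · exact measurable_norm.pow_const q
  set I : Euc N → ENNReal := S.indicator 1 with hI
  have hIm : Measurable I := measurable_one.indicator hS
  have bound : ∀ x y, ‖‖g x - g y‖ ^ p / ‖x - y‖ ^ q‖ₑ ≤ h (x - y) * I x + h (x - y) * I y := by
    intro x y
    have h1 : ‖‖g x - g y‖ ^ p / ‖x - y‖ ^ q‖ₑ ≤ h (x - y) := by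
      rw [Real.enorm_of_nonneg (by positivity)]
      refine ENNReal.ofReal_le_ofReal ?_
      have := Real.rpow_le_rpow (norm_nonneg _) (hgT x y) hp.le
      gcongr
    by_cases hx : x ∈ S
    · refine h1.trans (le_add_right ?_)
      simp [hI, hx]
    · by_cases hy : y ∈ S
      · refine h1.trans (le_add_left ?_)
        simp [hI, hy]
      · simp [hg x hx, hg y hy, Real.zero_rpow hp.ne']
  have hm1 : Measurable (Function.uncurry fun x y : Euc N => h (x - y) * I x) :=
    (hm.comp (measurable_fst.sub measurable_snd)).mul (hIm.comp measurable_fst)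
  have hm2 : Measurable (Function.uncurry fun x y : Euc N => h (x - y) * I y) :=
    (hm.comp (measurable_fst.sub measurable_snd)).mul (hIm.comp measurable_snd)
  have hIS : ∫⁻ x, I x = volume S := by rw [hI, lintegral_indicator_one hS]
  have t1 : ∫⁻ x, ∫⁻ y, h (x - y) * I x = (∫⁻ z, h z) * volume S := by
    have : ∀ x, ∫⁻ y, h (x - y) * I x = (∫⁻ z, h z) * I x := fun x => by
      have hx : Measurable fun y => h (x - y) := hm.comp (measurable_const.sub measurable_id)
      rw [lintegral_mul_const _ hx, lintegral_sub_left_eq_self]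
    simp only [this]
    rw [lintegral_const_mul _ hIm, hIS]
  have t2 : ∫⁻ x, ∫⁻ y, h (x - y) * I y = (∫⁻ z, h z) * volume S := by
    rw [lintegral_lintegral_swap hm2.aemeasurable]
    have : ∀ y, ∫⁻ x, h (x - y) * I y = (∫⁻ z, h z) * I y := fun y => by
      have hy : Measurable fun x => h (x - y) := hm.comp (measurable_id.sub measurable_const)
      rw [lintegral_mul_const _ hy, lintegral_sub_right_eq_self]
    simp only [this]
    rw [lintegral_const_mul _ hIm, hIS]
  refine integral_le_of_lintegral_enorm_le (by positivity) ?_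
  calc ∫⁻ x in Ω, ‖∫ y in Ω, ‖g x - g y‖ ^ p / ‖x - y‖ ^ q‖ₑ
      ≤ ∫⁻ x in Ω, ∫⁻ y in Ω, ‖‖g x - g y‖ ^ p / ‖x - y‖ ^ q‖ₑ :=
        lintegral_mono fun x => enorm_integral_le_lintegral_enorm _
    _ ≤ ∫⁻ x in Ω, ∫⁻ y, ‖‖g x - g y‖ ^ p / ‖x - y‖ ^ q‖ₑ :=
        lintegral_mono fun x => setLIntegral_le_lintegral _ _
    _ ≤ ∫⁻ x, ∫⁻ y, ‖‖g x - g y‖ ^ p / ‖x - y‖ ^ q‖ₑ := setLIntegral_le_lintegral _ _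
    _ ≤ ∫⁻ x, ∫⁻ y, (h (x - y) * I x + h (x - y) * I y) :=
        lintegral_mono fun x => lintegral_mono fun y => bound x y
    _ = ∫⁻ x, ((∫⁻ y, h (x - y) * I x) + ∫⁻ y, h (x - y) * I y) :=
        lintegral_congr fun x =>
          lintegral_add_left (hm1.comp (measurable_const.prodMk measurable_id)) _
    _ = 2 * ((∫⁻ z, h z) * volume S) := by
        have hm1' : Measurable fun x => ∫⁻ y, h (x - y) * I x := hm1.lintegral_prod_right'
        rw [lintegral_add_left hm1', t1, t2, two_mul]
    _ ≤ 2 * (ENNReal.ofReal κ * ENNReal.ofReal V) := by gcongr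
    _ = ENNReal.ofReal (2 * κ * V) := by
        rw [mul_assoc, ENNReal.ofReal_mul (by norm_num), ENNReal.ofReal_mul hκ0]
        simp

theorem sobNorm_le {N : ℕ} (Ω : Set (Euc N)) {s p : ℝ} (hp : 0 < p) {u : Euc N → ℝ}
    {S : Set (Euc N)} (hS : MeasurableSet S) {V κ E : ℝ} (hV : volume S ≤ ENNReal.ofReal V)
    (hV0 : 0 ≤ V) (hκ0 : 0 ≤ κ) (hE : ∀ j ≤ ⌊s⌋₊, ∀ x, ‖iteratedFDeriv ℝ j u x‖ ≤ E)
    (hu : ∀ j ≤ ⌊s⌋₊, ∀ x, x ∉ S → iteratedFDeriv ℝ j u x = 0) {T : ℝ → ℝ} (hT : Measurable T)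
    (huT : ∀ x y, ‖iteratedFDeriv ℝ ⌊s⌋₊ u x - iteratedFDeriv ℝ ⌊s⌋₊ u y‖ ≤ T ‖x - y‖)
    (hκ : (¬∃ k : ℕ, s = k) →
      ∫⁻ z : Euc N, ENNReal.ofReal (T ‖z‖ ^ p / ‖z‖ ^ ((N : ℝ) + (s - ⌊s⌋₊) * p)) ≤
        ENNReal.ofReal κ) :
    sobNorm Ω s p u ≤ (⌊s⌋₊ + 1) * (E * V ^ (1 / p)) + (2 * κ * V) ^ (1 / p) := by
  have h1 : intSobNorm Ω ⌊s⌋₊ p u ≤ (⌊s⌋₊ + 1) * (E * V ^ (1 / p)) := by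
    unfold intSobNorm
    refine (Finset.sum_le_card_nsmul _ _ (E * V ^ (1 / p)) fun j hj => ?_).trans_eq
      (by simp)
    have hj' : j ≤ ⌊s⌋₊ := Nat.lt_succ_iff.1 (Finset.mem_range.1 hj)
    exact integral_norm_rpow_le Ω hp hS hV hV0 (hE j hj') (hu j hj')
  unfold sobNorm
  split_ifs with hs
  · exact h1.trans (le_add_of_nonneg_right (by positivity))
  · refine add_le_add h1 (Real.rpow_le_rpow ?_ ?_ (by positivity))
    · exact integral_nonneg fun x => integral_nonneg fun y => by positivity
    · exact integral_integral_norm_sub_rpow_div_le Ω hp hS hV hV0 hκ0 hT huT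
        (hu _ le_rfl) (hκ hs)

theorem exists_norm_iteratedFDeriv_gridFn_sub_le (N m : ℕ) : ∃ C, 0 < C ∧
    ∀ (L : ℕ) (R : ℝ), 0 < R → ∀ x y,
      ‖iteratedFDeriv ℝ m (gridFn N L R) x - iteratedFDeriv ℝ m (gridFn N L R) y‖ ≤
        C * R ^ m * min (R * ‖x - y‖) 1 := by
  obtain ⟨C₀, hC₀, h0⟩ := exists_norm_iteratedFDeriv_gridFn_le N m
  obtain ⟨C₁, hC₁, h1⟩ := exists_norm_iteratedFDeriv_gridFn_le N (m + 1)
  refine ⟨2 * C₀ + C₁, by positivity, fun L R hR x y => ?_⟩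
  have hRm : 0 < R ^ m := pow_pos hR m
  have hd : Differentiable ℝ (iteratedFDeriv ℝ m (gridFn N L R)) :=
    (contDiff_gridFn (n := (m + 1 : ℕ)) N L R).differentiable_iteratedFDeriv
      (by exact_mod_cast Nat.lt_succ_self m)
  have hL : ‖iteratedFDeriv ℝ m (gridFn N L R) x - iteratedFDeriv ℝ m (gridFn N L R) y‖ ≤
      C₁ * R ^ (m + 1) * ‖x - y‖ :=
    convex_univ.norm_image_sub_le_of_norm_fderiv_le (𝕜 := ℝ) (fun z _ => hd z)
      (fun z _ => by rw [norm_fderiv_iteratedFDeriv]; exact h1 L R hR z) trivial trivial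
  have hB : ‖iteratedFDeriv ℝ m (gridFn N L R) x - iteratedFDeriv ℝ m (gridFn N L R) y‖ ≤
      2 * (C₀ * R ^ m) := by
    refine (norm_sub_le _ _).trans ?_
    linarith [h0 L R hR x, h0 L R hR y]
  rcases min_cases (R * ‖x - y‖) 1 with ⟨h, -⟩ | ⟨h, -⟩ <;> rw [h]
  · have : 0 ≤ R ^ m * (R * ‖x - y‖) := by positivity
    calc _ ≤ _ := hL
      _ = C₁ * (R ^ m * (R * ‖x - y‖)) := by ring
      _ ≤ (2 * C₀ + C₁) * (R ^ m * (R * ‖x - y‖)) := by gcongr; linarith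
      _ = _ := by ring
  · nlinarith

theorem iteratedFDeriv_eq_zero_of_tsupport_subset {N : ℕ} {u : Euc N → ℝ} {S : Set (Euc N)}
    (hu : tsupport u ⊆ S) (j : ℕ) (x : Euc N) (hx : x ∉ S) : iteratedFDeriv ℝ j u x = 0 := by
  by_contra h
  exact hx (hu (support_iteratedFDeriv_subset j h))

theorem exists_sobNorm_const_mul_gridFn_le {N : ℕ} (hN : 0 < N) {s p : ℝ} (hp : 0 < p)
    (hs : 0 ≤ s) : ∃ C, 0 < C ∧ ∀ (Ω : Set (Euc N)) (a : ℝ) (L : ℕ) (R : ℝ), 0 ≤ a → 1 ≤ R →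
      sobNorm Ω s p (a • gridFn N L R) ≤ C * (a * R ^ s * (L / R) ^ (N / p)) := by
  set m := ⌊s⌋₊ with hm
  have hms : (m : ℝ) ≤ s := Nat.floor_le hs
  choose B hB0 hB using exists_norm_iteratedFDeriv_gridFn_le N
  obtain ⟨D, hD0, hD⟩ := exists_norm_iteratedFDeriv_gridFn_sub_le N m
  obtain ⟨Q, hQ0, hQ⟩ : ∃ Q, 0 ≤ Q ∧ ((¬∃ k : ℕ, s = k) → ∀ R : ℝ, 0 < R →
      ∫⁻ z : Euc N, ENNReal.ofReal (min (R * ‖z‖) 1 ^ p / ‖z‖ ^ ((N : ℝ) + (s - m) * p)) ≤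
        ENNReal.ofReal (Q * R ^ ((s - m) * p))) := by
    by_cases hk : ∃ k : ℕ, s = k
    · exact ⟨0, le_rfl, fun h => absurd hk h⟩
    · have hlt : (m : ℝ) < s := lt_of_le_of_ne hms fun h => hk ⟨m, h.symm⟩
      have hlt' : s < m + 1 := Nat.lt_floor_add_one s
      obtain ⟨Q, hQ0, hQ⟩ := exists_lintegral_min_norm_rpow_div_le hN hp (σ := s - m)
        (by linarith) (by linarith)
      exact ⟨Q, hQ0, fun _ => hQ⟩
  set A : ℝ := ∑ j ∈ Finset.range (m + 1), B j with hA
  have hA0 : 0 ≤ A := Finset.sum_nonneg fun j _ => (hB0 j).le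
  have hBA : ∀ j ≤ m, B j ≤ A := fun j hj =>
    Finset.single_le_sum (f := B) (fun i _ => (hB0 i).le)
      (Finset.mem_range.2 (Nat.lt_succ_of_le hj))
  refine ⟨((m + 1) * A + D * (2 * Q) ^ (1 / p)) * 2 ^ (N / p) + 1, by positivity,
    fun Ω a L R ha hR => ?_⟩
  have hR0 : 0 < R := one_pos.trans_le hR
  have hi : ∀ (j : ℕ) x, iteratedFDeriv ℝ j (a • gridFn N L R) x =
      a • iteratedFDeriv ℝ j (gridFn N L R) x := fun j x =>
    iteratedFDeriv_const_smul_apply (contDiff_gridFn (n := j) N L R).contDiffAt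
  have hρ : 0 ≤ (L : ℝ) / R := by positivity
  have key := sobNorm_le Ω (s := s) (p := p) hp (u := a • gridFn N L R)
    (S := cube N (L / R)) (isClosed_cube _ _).measurableSet (V := (2 * (L / R)) ^ N)
    (κ := (a * D * R ^ m) ^ p * (Q * R ^ ((s - m) * p))) (E := a * (A * R ^ m))
    (T := fun t => a * D * R ^ m * min (R * t) 1)
    (volume_cube N hρ).le (by positivity) (by positivity)
    (fun j hj x => by
      rw [hi, norm_smul, Real.norm_of_nonneg ha]
      refine mul_le_mul_of_nonneg_left ((hB j L R hR0 x).trans ?_) ha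
      exact mul_le_mul (hBA j hj) (pow_le_pow_right₀ hR hj) (by positivity) hA0)
    (fun j _ x hx => by
      rw [hi, iteratedFDeriv_eq_zero_of_tsupport_subset (tsupport_gridFn_subset N L hR0) j x hx,
        smul_zero])
    (by fun_prop)
    (fun x y => by
      rw [hi, hi, ← smul_sub, norm_smul, Real.norm_of_nonneg ha, mul_assoc, mul_assoc]
      exact mul_le_mul_of_nonneg_left (by simpa only [mul_assoc] using hD L R hR0 x y) ha)
    (fun hk => by
      have e : ∀ z : Euc N, ENNReal.ofReal ((a * D * R ^ m * min (R * ‖z‖) 1) ^ p /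
          ‖z‖ ^ ((N : ℝ) + (s - m) * p)) = ENNReal.ofReal ((a * D * R ^ m) ^ p) *
          ENNReal.ofReal (min (R * ‖z‖) 1 ^ p / ‖z‖ ^ ((N : ℝ) + (s - m) * p)) := by
        intro z
        rw [← ENNReal.ofReal_mul (by positivity), Real.mul_rpow (by positivity) (by positivity),
          mul_div_assoc]
      simp only [← hm, e]
      rw [lintegral_const_mul' _ _ ENNReal.ofReal_ne_top, ENNReal.ofReal_mul (by positivity)]
      gcongr
      exact hQ hk R hR0)
  refine key.trans ?_
  rw [← hm]
  have e1 : ((2 * ((L : ℝ) / R)) ^ N) ^ (1 / p) = 2 ^ (N / p) * (L / R) ^ (N / p) := by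
    rw [← Real.rpow_natCast, ← Real.rpow_mul (by positivity), mul_one_div,
      Real.mul_rpow (by norm_num) hρ]
  have e2 : (2 * ((a * D * R ^ m) ^ p * (Q * R ^ ((s - m) * p))) * (2 * (L / R)) ^ N) ^ (1 / p) =
      a * D * R ^ s * (2 * Q) ^ (1 / p) * (2 ^ (N / p) * (L / R) ^ (N / p)) := by
    rw [Real.mul_rpow (by positivity) (by positivity), e1]
    congr 1
    rw [show 2 * ((a * D * R ^ m) ^ p * (Q * R ^ ((s - m) * p))) =
      (a * D * R ^ m) ^ p * R ^ ((s - m) * p) * (2 * Q) by ring,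
      Real.mul_rpow (by positivity) (by positivity), Real.mul_rpow (by positivity) (by positivity),
      ← Real.rpow_mul (by positivity), ← Real.rpow_mul (by positivity), mul_assoc (s - m),
      mul_one_div_cancel hp.ne', Real.rpow_one, mul_one, Real.rpow_sub hR0, Real.rpow_natCast]
    field_simp
  rw [e1, e2]
  have hRs : R ^ m ≤ R ^ s := by
    rw [← Real.rpow_natCast]
    exact Real.rpow_le_rpow_of_exponent_le hR hms
  have hX : 0 ≤ a * R ^ s * (L / R) ^ (N / p) := by positivity
  have h1 : ((m : ℝ) + 1) * (a * (A * R ^ m) * (2 ^ (N / p) * (L / R) ^ (N / p))) ≤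
      ((m : ℝ) + 1) * (a * (A * R ^ s) * (2 ^ (N / p) * (L / R) ^ (N / p))) := by gcongr
  refine (add_le_add_left h1 _).trans ?_
  nlinarith

/-- A uniform bound for `∑ j, (2 ^ j t) ^ (-σ) * min (2 ^ j t) 1`. -/
theorem exists_sum_rpow_neg_mul_min_le {σ : ℝ} (h0 : 0 < σ) (h1 : σ < 1) : ∃ C, 0 < C ∧
    ∀ (n : ℕ) (t : ℝ), 0 ≤ t →
      ∑ j ∈ Finset.range n, ((2 : ℝ) ^ j * t) ^ (-σ) * min ((2 : ℝ) ^ j * t) 1 ≤ C := by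
  set δ := min σ (1 - σ) with hδ
  have hδ0 : 0 < δ := lt_min h0 (by linarith)
  set q : ℝ := 2 ^ δ with hq
  have hq1 : 1 < q := Real.one_lt_rpow (by norm_num) hδ0
  set Φ : ℝ → ℝ := fun t => t ^ δ / (1 + t ^ δ) with hΦ
  have hstep : ∀ t : ℝ, 0 < t → t ^ (-σ) * min t 1 ≤ 4 * q / (q - 1) * (Φ (2 * t) - Φ t) := by
    intro t ht
    set y := t ^ δ with hy
    have hy0 : 0 < y := Real.rpow_pos_of_pos ht _
    have e : Φ (2 * t) - Φ t = (q - 1) * y / ((1 + q * y) * (1 + y)) := by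
      simp only [hΦ]
      rw [Real.mul_rpow (by norm_num) ht.le, ← hq, ← hy]
      field_simp
      ring
    have h2 : 4 * q / (q - 1) * (Φ (2 * t) - Φ t) = 4 * q * y / ((1 + q * y) * (1 + y)) := by
      have : q - 1 ≠ 0 := by linarith
      rw [e]
      field_simp
    rw [h2, le_div_iff₀ (by positivity)]
    rcases le_total t 1 with ht1 | ht1
    · have hy1 : y ≤ 1 := Real.rpow_le_one ht.le ht1 hδ0.le
      have : t ^ (-σ) * min t 1 ≤ y := by
        rw [min_eq_left ht1, ← Real.rpow_add_one ht.ne']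
        exact Real.rpow_le_rpow_of_exponent_ge ht ht1 (by linarith [min_le_right σ (1 - σ)])
      refine (mul_le_mul_of_nonneg_right this (by positivity)).trans ?_
      have : (1 + q * y) * (1 + y) ≤ 4 * q := by nlinarith [mul_nonneg hy0.le (sub_nonneg.2 hy1)]
      nlinarith
    · have hy1 : 1 ≤ y := Real.one_le_rpow ht1 hδ0.le
      have : t ^ (-σ) * min t 1 ≤ y⁻¹ := by
        rw [min_eq_right ht1, mul_one, hy, ← Real.rpow_neg ht.le]
        exact Real.rpow_le_rpow_of_exponent_le ht1 (by linarith [min_le_left σ (1 - σ)])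
      refine (mul_le_mul_of_nonneg_right this (by positivity)).trans ?_
      have : (1 + q * y) * (1 + y) ≤ 4 * q * y * y := by
        have : 1 + q * y ≤ 2 * q * y := by nlinarith
        have : 1 + y ≤ 2 * y := by linarith
        calc _ ≤ (2 * q * y) * (2 * y) := by gcongr
          _ = _ := by ring
      rw [inv_mul_le_iff₀ hy0]
      linarith
  have hC : 0 < 4 * q / (q - 1) := div_pos (by positivity) (by linarith)
  refine ⟨4 * q / (q - 1), hC, fun n t ht => ?_⟩
  rcases ht.eq_or_lt with rfl | ht
  · simpa using hC.le
  · have hΦ1 : ∀ t, 0 < t → Φ t ≤ 1 := fun t ht => by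
      have := Real.rpow_pos_of_pos ht δ
      rw [hΦ, div_le_one (by positivity)]
      linarith
    have hΦ0 : 0 ≤ Φ t := by simp only [hΦ]; positivity
    calc _ ≤ ∑ j ∈ Finset.range n,
          4 * q / (q - 1) * (Φ ((2 : ℝ) ^ (j + 1) * t) - Φ ((2 : ℝ) ^ j * t)) := by
          refine Finset.sum_le_sum fun j _ => ?_
          have := hstep ((2 : ℝ) ^ j * t) (by positivity)
          rwa [← mul_assoc 2, ← pow_succ'] at this
      _ = 4 * q / (q - 1) * (Φ ((2 : ℝ) ^ n * t) - Φ t) := by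
          rw [← Finset.mul_sum, Finset.sum_range_sub fun j => Φ ((2 : ℝ) ^ j * t)]
          simp
      _ ≤ 4 * q / (q - 1) * 1 := by
          refine mul_le_mul_of_nonneg_left ?_ hC.le
          linarith [hΦ1 ((2 : ℝ) ^ n * t) (by positivity)]
      _ = _ := mul_one _

theorem contDiff_pderiv' {N : ℕ} {n m : WithTop ℕ∞} {u : Euc N → ℝ} (hu : ContDiff ℝ n u)
    (hmn : m + 1 ≤ n) (a : Fin N) : ContDiff ℝ m (pderiv' a u) :=
  (hu.fderiv_right hmn).clm_apply contDiff_const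

theorem tsupport_pderiv'_subset {N : ℕ} (a : Fin N) (u : Euc N → ℝ) :
    tsupport (pderiv' a u) ⊆ tsupport u := by
  refine (closure_mono fun x hx => ?_).trans (tsupport_fderiv_subset ℝ)
  intro h
  exact hx (by simp only [pderiv', h, zero_apply])

theorem pderiv'_sum_smul {N : ℕ} (a : Fin N) {ι : Type*} (S : Finset ι) (c : ι → ℝ)
    {v : ι → Euc N → ℝ} (hv : ∀ j, Differentiable ℝ (v j)) :
    pderiv' a (∑ j ∈ S, c j • v j) = ∑ j ∈ S, c j • pderiv' a (v j) := by
  ext x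
  unfold pderiv'
  rw [fderiv_sum fun j _ => ((hv j).const_smul (c j)) x]
  simp only [sum_apply, Finset.sum_apply, Pi.smul_apply]
  exact Finset.sum_congr rfl fun j _ => by rw [fderiv_const_smul (hv j x)]; rfl

section HessMinor

variable {N r : ℕ} (h : r ≤ N)

theorem hessMinor_eq_zero {u : Euc N → ℝ} {x : Euc N} (hx : x ∉ tsupport u) :
    hessMinor h u x = 0 := by
  ext a b
  change pderiv' _ (pderiv' _ u) x = 0
  exact image_eq_zero_of_notMem_tsupport fun h' =>
    hx (tsupport_pderiv'_subset _ _ (tsupport_pderiv'_subset _ _ h'))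

theorem continuous_hessMinor {u : Euc N → ℝ} (hu : ContDiff ℝ 2 u) :
    Continuous (hessMinor h u) :=
  continuous_matrix fun _ _ => (contDiff_pderiv' (m := 0)
    (contDiff_pderiv' (m := 1) hu (by norm_num) _) (by norm_num) _).continuous

theorem hessMinor_sum_smul {ι : Type*} (S : Finset ι) (c : ι → ℝ) {v : ι → Euc N → ℝ}
    (hv : ∀ j, ContDiff ℝ 2 (v j)) (x : Euc N) :
    hessMinor h (∑ j ∈ S, c j • v j) x = ∑ j ∈ S, c j • hessMinor h (v j) x := by
  ext a b
  simp only [hessMinor, Matrix.of_apply, Matrix.sum_apply, Matrix.smul_apply]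
  rw [pderiv'_sum_smul _ _ _ fun j => (hv j).differentiable two_ne_zero,
    pderiv'_sum_smul _ _ _ fun j =>
      (contDiff_pderiv' (m := 1) (hv j) (by norm_num) _).differentiable one_ne_zero]
  simp only [Finset.sum_apply, Pi.smul_apply]

theorem hessMinor_const_smul (c : ℝ) {v : Euc N → ℝ} (hv : ContDiff ℝ 2 v) (x : Euc N) :
    hessMinor h (c • v) x = c • hessMinor h v x := by
  simpa using hessMinor_sum_smul h {()} (fun _ => c) (fun _ => hv) x

end HessMinor

/-- A test function which is the square of a coordinate on the unit cube. -/
theorem exists_isCinfc_eq_sq {N : ℕ} {Ω : Set (Euc N)} (hΩ : cube N 2 ⊆ Ω) (i₀ : Fin N) :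
    ∃ ψ, IsCinfc Ω ψ ∧ ∀ x ∈ cube N 1, ψ x = x i₀ ^ 2 := by
  let χ : ContDiffBump (0 : ℝ) :=
    { rIn := 1, rOut := 2, rIn_pos := by norm_num, rIn_lt_rOut := by norm_num }
  have hs : tsupport (fun x : Euc N => tensorFn (fun _ => χ) x * x i₀ ^ 2) ⊆ cube N 2 := by
    refine closure_minimal (fun x hx i => ?_) (isClosed_cube _ _)
    by_contra hi
    refine hx ?_
    have : χ (x i) = 0 := χ.zero_of_le_dist (by
      rw [dist_zero_right, Real.norm_eq_abs]
      exact (not_le.1 hi).le)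
    simp only [tensorFn]
    rw [Finset.prod_eq_zero (Finset.mem_univ i) this, zero_mul]
  refine ⟨fun x => tensorFn (fun _ => χ) x * x i₀ ^ 2, ⟨?_, ?_, hs.trans hΩ⟩, fun x hx => ?_⟩
  · exact (contDiff_tensorFn fun _ => χ.contDiff).mul (by fun_prop)
  · exact (isCompact_cube N 2).of_isClosed_subset (isClosed_tsupport _) hs
  · simp only [tensorFn]
    rw [Finset.prod_eq_one fun i _ => χ.one_of_mem_closedBall ?_, one_mul]
    rw [Metric.mem_closedBall, dist_zero_right, Real.norm_eq_abs]
    exact hx i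

theorem setIntegral_det_hessMinor_gridFn {N r : ℕ} (h : r ≤ N) (hr : 1 < r) {Ω : Set (Euc N)}
    (hΩ : cube N 1 ⊆ Ω) {ψ : Euc N → ℝ}
    (hψ : ∀ x ∈ cube N 1, ψ x = x (Fin.castLE h ⟨0, by omega⟩) ^ 2) {L : ℕ} {R : ℝ} (hR : 0 < R)
    (hL : L ≤ R) : ∫ x in Ω, (hessMinor h (gridFn N L R) x).det * ψ x =
      ∫ x, (hessMinor h (gridFn N L R) x).det * x (Fin.castLE h ⟨0, by omega⟩) ^ 2 := by
  have hs : tsupport (gridFn N L R) ⊆ cube N 1 := (tsupport_gridFn_subset N L hR).trans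
    fun x hx i => (hx i).trans ((div_le_one hR).2 hL)
  have : Nonempty (Fin r) := ⟨⟨0, by omega⟩⟩
  have h0 : ∀ x ∉ cube N 1, (hessMinor h (gridFn N L R) x).det = 0 := fun x hx => by
    rw [hessMinor_eq_zero h fun hx' => hx (hs hx'), Matrix.det_zero]
  rw [setIntegral_eq_integral_of_forall_compl_eq_zero fun x hx => by
    rw [h0 x fun hx' => hx (hΩ hx'), zero_mul]]
  congr 1
  ext x
  by_cases hx : x ∈ cube N 1
  · rw [hψ x hx]
  · rw [h0 x hx, zero_mul, zero_mul]

/-- Concentration at a single scale: `e = 0` spreads bumps over the unit cube, `e = 1` uses a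
single bump. -/
theorem exists_sobNorm_lt_of_single_scale {N r : ℕ} (h : r ≤ N) (hr : 1 < r) {Ω : Set (Euc N)}
    (hΩ : cube N 1 ⊆ Ω) {ψ : Euc N → ℝ}
    (hψ : ∀ x ∈ cube N 1, ψ x = x (Fin.castLE h ⟨0, by omega⟩) ^ 2) {s p : ℝ} (hp : 0 < p)
    (hs : 0 ≤ s) {e : ℝ} (he : 0 ≤ e) {L : ℕ → ℕ}
    (hL : ∀ k : ℕ, 0 < k → (L k : ℝ) / k = (k : ℝ) ^ (-e))
    (hlt : s - e * (N / p) < 2 - 2 / r - e * (N / r)) {ε : ℝ} (hε : 0 < ε) (K : ℝ) :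
    ∃ u : Euc N → ℝ, ContDiff ℝ 2 u ∧ sobNorm Ω s p u < ε ∧
      K ≤ |∫ x in Ω, (hessMinor h u x).det * ψ x| := by
  obtain ⟨τ, hτ1, hτ2⟩ := exists_between hlt
  obtain ⟨C, -, hC⟩ := exists_sobNorm_const_mul_gridFn_le (N := N) (by omega) hp hs
  obtain ⟨c, hc0, hc⟩ := exists_integral_det_hessMinor_gridFn h hr
  have hr0 : (0 : ℝ) < r := by positivity
  have t1 : Tendsto (fun k : ℕ => C * (k : ℝ) ^ (-(τ - (s - e * (N / p))))) atTop (𝓝 0) := by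
    simpa using ((tendsto_rpow_neg_atTop (sub_pos.2 hτ1)).comp
      tendsto_natCast_atTop_atTop).const_mul C
  have t2 : Tendsto (fun k : ℕ => |c| * (k : ℝ) ^ (r * (2 - 2 / r - e * (N / r) - τ)))
      atTop atTop :=
    ((tendsto_rpow_atTop (mul_pos hr0 (sub_pos.2 hτ2))).comp
      tendsto_natCast_atTop_atTop).const_mul_atTop (abs_pos.2 hc0)
  obtain ⟨k, hk1, hk2, hk3⟩ := ((t1.eventually_lt_const hε).and
    ((t2.eventually_ge_atTop K).and (eventually_gt_atTop 0))).exists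
  have hk0 : (0 : ℝ) < k := by exact_mod_cast hk3
  have hk' : (1 : ℝ) ≤ k := by exact_mod_cast hk3
  have hLk : (L k : ℝ) ≤ k := by
    rw [← div_le_one hk0, hL k hk3]
    exact Real.rpow_le_one_of_one_le_of_nonpos hk' (by linarith)
  refine ⟨(k : ℝ) ^ (-τ) • gridFn N (L k) k,
    (contDiff_gridFn (n := 2) N (L k) k).const_smul ((k : ℝ) ^ (-τ)),
    ((hC Ω _ (L k) k (by positivity) hk').trans_eq ?_).trans_lt hk1, hk2.trans_eq ?_⟩
  · rw [hL k hk3, ← Real.rpow_mul hk0.le, ← Real.rpow_add hk0, ← Real.rpow_add hk0]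
    ring_nf
  · simp_rw [hessMinor_const_smul h _ (contDiff_gridFn (n := 2) N (L k) k), Matrix.det_smul,
      Fintype.card_fin, mul_assoc]
    rw [integral_const_mul, setIntegral_det_hessMinor_gridFn h hr hΩ hψ hk0 hLk, hc _ _ hk0,
      hL k hk3, abs_mul, abs_mul, abs_mul, abs_of_pos (by positivity : (0 : ℝ) < (k ^ (-τ)) ^ r),
      abs_of_pos (by positivity : (0 : ℝ) < (k : ℝ) ^ (2 * r - 2)),
      abs_of_pos (by positivity : (0 : ℝ) < ((k : ℝ) ^ (-e)) ^ N)]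
    have e1 : ((k : ℝ) ^ (2 * r - 2)) = (k : ℝ) ^ (2 * (r : ℝ) - 2) := by
      rw [← Real.rpow_natCast, Nat.cast_sub (by omega)]
      push_cast; rfl
    rw [e1, ← Real.rpow_mul_natCast hk0.le, ← Real.rpow_mul_natCast hk0.le, mul_assoc,
      mul_left_comm, ← Real.rpow_add hk0, ← Real.rpow_add hk0]
    congr 2
    field_simp
    ring

theorem exists_lintegral_sum_rpow_div_le {N : ℕ} (hN : 0 < N) {p σ : ℝ} (hp : 1 ≤ p)
    (h0 : 0 < σ) (h1 : σ < 1) : ∃ C, 0 ≤ C ∧ ∀ n : ℕ,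
      ∫⁻ z : Euc N, ENNReal.ofReal
        ((∑ j ∈ Finset.range n, ((2 : ℝ) ^ j) ^ (-σ) * min ((2 : ℝ) ^ j * ‖z‖) 1) ^ p /
          ‖z‖ ^ ((N : ℝ) + σ * p)) ≤ ENNReal.ofReal (C * n) := by
  obtain ⟨A, hA0, hA⟩ := exists_sum_rpow_neg_mul_min_le h0 h1
  obtain ⟨Q, hQ0, hQ⟩ := exists_lintegral_min_norm_rpow_div_le hN one_pos h0 h1
  simp only [Real.rpow_one, mul_one] at hQ
  refine ⟨A ^ (p - 1) * Q, by positivity, fun n => ?_⟩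
  have hpt : ∀ z : Euc N,
      (∑ j ∈ Finset.range n, ((2 : ℝ) ^ j) ^ (-σ) * min ((2 : ℝ) ^ j * ‖z‖) 1) ^ p /
          ‖z‖ ^ ((N : ℝ) + σ * p) ≤
        ∑ j ∈ Finset.range n, A ^ (p - 1) * ((2 : ℝ) ^ j) ^ (-σ) *
          (min ((2 : ℝ) ^ j * ‖z‖) 1 / ‖z‖ ^ ((N : ℝ) + σ)) := by
    intro z
    rcases (norm_nonneg z).eq_or_lt with hz | hz
    · simp [← hz, Real.zero_rpow (by linarith : p ≠ 0)]
    set t := ‖z‖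
    set M := ∑ j ∈ Finset.range n, ((2 : ℝ) ^ j * t) ^ (-σ) * min ((2 : ℝ) ^ j * t) 1 with hM
    have hM0 : 0 ≤ M := Finset.sum_nonneg fun j _ => by positivity
    have e1 : ∑ j ∈ Finset.range n, ((2 : ℝ) ^ j) ^ (-σ) * min ((2 : ℝ) ^ j * t) 1 =
        t ^ σ * M := by
      rw [hM, Finset.mul_sum]
      refine Finset.sum_congr rfl fun j _ => ?_
      rw [Real.mul_rpow (by positivity) hz.le, ← mul_assoc, mul_left_comm, ← Real.rpow_add hz]
      simp
    have e2 : ∑ j ∈ Finset.range n, A ^ (p - 1) * ((2 : ℝ) ^ j) ^ (-σ) *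
        (min ((2 : ℝ) ^ j * t) 1 / t ^ ((N : ℝ) + σ)) = A ^ (p - 1) * M / t ^ (N : ℝ) := by
      rw [Real.rpow_add hz, eq_div_iff (by positivity), Finset.sum_mul, hM, Finset.mul_sum]
      refine Finset.sum_congr rfl fun j _ => ?_
      rw [Real.mul_rpow (by positivity) hz.le, Real.rpow_neg hz.le]
      field_simp
    rw [e1, e2, Real.mul_rpow (by positivity) hM0, ← Real.rpow_mul hz.le, add_comm,
      Real.rpow_add hz, mul_div_mul_left _ _ (by positivity)]
    gcongr
    calc M ^ p = M ^ (p - 1) * M := by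
          rw [← Real.rpow_add_one' hM0 (by linarith), sub_add_cancel]
      _ ≤ A ^ (p - 1) * M := by
          gcongr
          exact hA n t hz.le
  calc _ ≤ ∫⁻ z : Euc N, ∑ j ∈ Finset.range n, ENNReal.ofReal (A ^ (p - 1) *
        ((2 : ℝ) ^ j) ^ (-σ)) *
          ENNReal.ofReal (min ((2 : ℝ) ^ j * ‖z‖) 1 / ‖z‖ ^ ((N : ℝ) + σ)) := by
        refine lintegral_mono fun z => (ENNReal.ofReal_le_ofReal (hpt z)).trans_eq ?_
        rw [ENNReal.ofReal_sum_of_nonneg fun j _ => by positivity]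
        exact Finset.sum_congr rfl fun j _ => ENNReal.ofReal_mul (by positivity)
    _ = ∑ j ∈ Finset.range n, ENNReal.ofReal (A ^ (p - 1) * ((2 : ℝ) ^ j) ^ (-σ)) *
          ∫⁻ z : Euc N, ENNReal.ofReal (min ((2 : ℝ) ^ j * ‖z‖) 1 / ‖z‖ ^ ((N : ℝ) + σ)) := by
        have hm : ∀ j : ℕ, Measurable fun z : Euc N =>
            ENNReal.ofReal (min ((2 : ℝ) ^ j * ‖z‖) 1 / ‖z‖ ^ ((N : ℝ) + σ)) := fun j => by
          fun_prop
        rw [lintegral_finsetSum _ fun j _ => (hm j).const_mul _]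
        exact Finset.sum_congr rfl fun j _ => lintegral_const_mul _ (hm j)
    _ ≤ ∑ j ∈ Finset.range n, ENNReal.ofReal (A ^ (p - 1) * Q) := by
        refine Finset.sum_le_sum fun j _ => ?_
        refine (mul_le_mul_right (hQ _ (by positivity)) _).trans_eq ?_
        rw [← ENNReal.ofReal_mul (by positivity)]
        congr 1
        rw [Real.rpow_neg (by positivity)]
        field_simp
    _ = _ := by
        rw [Finset.sum_const, Finset.card_range, nsmul_eq_mul, mul_comm _ (n : ℝ),
          ENNReal.ofReal_mul (Nat.cast_nonneg n), ENNReal.ofReal_natCast]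

/-- A sum of oscillations over the dyadic scales with critical amplitudes. -/
theorem exists_sobNorm_sum_gridFn_le {N : ℕ} (hN : 0 < N) {s p : ℝ} (hp : 1 ≤ p) (hs1 : 1 < s)
    (hs2 : s < 2) : ∃ C, 0 < C ∧ ∀ (Ω : Set (Euc N)) (n : ℕ) (A : ℝ) (b : ℕ → ℝ), 0 ≤ A →
      (∀ j, |b j| ≤ A * ((2 : ℝ) ^ j) ^ (-s)) →
      sobNorm Ω s p (∑ j ∈ Finset.range n, b j • gridFn N (2 ^ j) ((2 : ℝ) ^ j)) ≤
        C * (A * (1 + (n : ℝ) ^ (1 / p))) := by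
  have hp0 : 0 < p := by linarith
  have hfl : ⌊s⌋₊ = 1 := (Nat.floor_eq_iff (by linarith)).2 ⟨by simpa using hs1.le, by
    norm_num; linarith⟩
  choose B hB0 hB using exists_norm_iteratedFDeriv_gridFn_le N
  obtain ⟨D, hD0, hD⟩ := exists_norm_iteratedFDeriv_gridFn_sub_le N 1
  obtain ⟨M, hM0, hM⟩ := exists_sum_rpow_neg_mul_min_le (σ := s - 1) (by linarith) (by linarith)
  obtain ⟨Q, hQ0, hQ⟩ := exists_lintegral_sum_rpow_div_le hN (σ := s - 1) hp (by linarith)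
    (by linarith)
  refine ⟨2 * ((B 0 + B 1) * M * ((2 : ℝ) ^ N) ^ (1 / p)) +
    D * (2 * Q * 2 ^ N) ^ (1 / p), ?_, fun Ω n A b hA hb => ?_⟩
  · have := hB0 0
    have := hB0 1
    positivity
  set v : ℕ → Euc N → ℝ := fun j => gridFn N (2 ^ j) ((2 : ℝ) ^ j) with hv
  have hpos : ∀ j : ℕ, (0 : ℝ) < 2 ^ j := fun j => by positivity
  have hone : ∀ j : ℕ, (1 : ℝ) ≤ 2 ^ j := fun j => one_le_pow₀ (by norm_num)
  have hvs : ∀ j, tsupport (v j) ⊆ cube N 1 := fun j => by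
    refine (tsupport_gridFn_subset N (2 ^ j) (hpos j)).trans_eq ?_
    rw [Nat.cast_pow, Nat.cast_ofNat, div_self (hpos j).ne']
  have hi : ∀ (i : ℕ) x, iteratedFDeriv ℝ i (∑ j ∈ Finset.range n, b j • v j) x =
      ∑ j ∈ Finset.range n, b j • iteratedFDeriv ℝ i (v j) x := fun i x => by
    have hc : ∀ j, ContDiffAt ℝ i (v j) x := fun j =>
      (contDiff_gridFn (n := i) N (2 ^ j) (2 ^ j)).contDiffAt
    rw [iteratedFDeriv_sum_apply (f := fun j => b j • v j) fun j _ => (hc j).const_smul (b j)]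
    exact Finset.sum_congr rfl fun j _ => iteratedFDeriv_const_smul_apply (hc j)
  have hpw : ∀ j : ℕ, ((2 : ℝ) ^ j) ^ (-s) * 2 ^ j = (2 ^ j) ^ (-(s - 1)) := fun j => by
    rw [← Real.rpow_add_one (hpos j).ne']
    congr 1
    ring
  have hS : ∑ j ∈ Finset.range n, ((2 : ℝ) ^ j) ^ (-(s - 1)) ≤ M := by
    have := hM n 1 zero_le_one
    simp only [mul_one] at this
    simpa only [min_eq_right (hone _), mul_one] using this
  have hB' : ∀ i ≤ 1, ∀ j x, ‖iteratedFDeriv ℝ i (v j) x‖ ≤ (B 0 + B 1) * 2 ^ j := by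
    intro i hi' j x
    refine (hB i _ _ (hpos j) x).trans ?_
    have h0 := hB0 0
    have h1 := hB0 1
    have h2 := hone j
    interval_cases i
    · rw [pow_zero]
      nlinarith
    · rw [pow_one]
      nlinarith
  have key := sobNorm_le Ω (s := s) hp0 (u := ∑ j ∈ Finset.range n, b j • v j)
    (isClosed_cube N 1).measurableSet (V := 2 ^ N)
    (κ := (A * D) ^ p * (Q * n)) (E := A * ((B 0 + B 1) * M))
    (T := fun t => A * D * ∑ j ∈ Finset.range n,
      ((2 : ℝ) ^ j) ^ (-(s - 1)) * min ((2 : ℝ) ^ j * t) 1)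
    ((volume_cube N zero_le_one).trans_le (by rw [mul_one])) (by positivity) (by positivity)
    (fun i hi' x => by
      rw [hi]
      calc _ ≤ ∑ j ∈ Finset.range n, A * (B 0 + B 1) * ((2 : ℝ) ^ j) ^ (-(s - 1)) := by
            refine norm_sum_le_of_le _ fun j _ => ?_
            rw [norm_smul, Real.norm_eq_abs, ← hpw]
            refine (mul_le_mul (hb j) (hB' i (by omega) j x) (norm_nonneg _)
              (by positivity)).trans_eq (by ring)
        _ ≤ _ := by
            rw [← Finset.mul_sum, ← mul_assoc]
            have := hB0 0
            have := hB0 1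
            gcongr)
    (fun i _ x hx => by
      rw [hi]
      exact Finset.sum_eq_zero fun j _ => by
        rw [iteratedFDeriv_eq_zero_of_tsupport_subset (hvs j) i x hx, smul_zero])
    (by fun_prop)
    (fun x y => by
      rw [hi, hi, hfl, ← Finset.sum_sub_distrib, Finset.mul_sum]
      refine norm_sum_le_of_le _ fun j _ => ?_
      rw [← smul_sub, norm_smul, Real.norm_eq_abs, ← hpw]
      refine (mul_le_mul (hb j) (hD _ _ (hpos j) x y) (norm_nonneg _)
        (by positivity)).trans_eq (by ring))
    (fun _ => by
      rw [hfl, Nat.cast_one, ENNReal.ofReal_mul (by positivity)]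
      refine le_trans (le_of_eq ?_) (mul_le_mul_right (hQ n) _)
      rw [← lintegral_const_mul' _ _ ENNReal.ofReal_ne_top]
      congr 1
      ext z
      rw [← ENNReal.ofReal_mul (by positivity), Real.mul_rpow (by positivity)
        (Finset.sum_nonneg fun j _ => by positivity), mul_div_assoc])
  refine key.trans ?_
  have hAD : 0 ≤ A * D := by positivity
  have e1 : (2 * ((A * D) ^ p * (Q * n)) * 2 ^ N) ^ (1 / p) =
      A * D * (2 * Q * 2 ^ N) ^ (1 / p) * (n : ℝ) ^ (1 / p) := by
    rw [show 2 * ((A * D) ^ p * (Q * n)) * 2 ^ N = (A * D) ^ p * ((2 * Q * 2 ^ N) * n) by ring,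
      Real.mul_rpow (by positivity : 0 ≤ (A * D) ^ p) (by positivity), ← Real.rpow_mul hAD,
      Real.mul_rpow (by positivity : 0 ≤ 2 * Q * 2 ^ N) (by positivity), mul_one_div_cancel hp0.ne',
      Real.rpow_one]
    ring
  rw [e1, hfl, Nat.cast_one]
  have h0 := hB0 0
  have h1 := hB0 1
  have hn : (0 : ℝ) ≤ (n : ℝ) ^ (1 / p) := by positivity
  set X := (B 0 + B 1) * M * ((2 : ℝ) ^ N) ^ (1 / p) with hX
  set Y := (2 * Q * 2 ^ N) ^ (1 / p) with hY
  have hX0 : 0 ≤ X := by positivity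
  have hY0 : 0 ≤ Y := by positivity
  have hAX := mul_nonneg (mul_nonneg hA hX0) hn
  have hAY := mul_nonneg hAD hY0
  have e2 : A * ((B 0 + B 1) * M) * (2 ^ N) ^ (1 / p) = A * X := by rw [hX]; ring
  rw [e2]
  nlinarith

theorem exists_sobNorm_lt_of_multi_scale {N r : ℕ} (h : r ≤ N) (hr : 1 < r) {Ω : Set (Euc N)}
    (hΩ : cube N 1 ⊆ Ω) {ψ : Euc N → ℝ} (hψc : Continuous ψ) (hψs : HasCompactSupport ψ)
    (hψ : ∀ x ∈ cube N 1, ψ x = x (Fin.castLE h ⟨0, by omega⟩) ^ 2) {s p : ℝ} (hrp : r < p)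
    (hs : s = 2 - 2 / (r : ℝ)) (hs1 : 1 < s) {ε : ℝ} (hε : 0 < ε) (K : ℝ) :
    ∃ u : Euc N → ℝ, ContDiff ℝ 2 u ∧ sobNorm Ω s p u < ε ∧
      K ≤ |∫ x in Ω, (hessMinor h u x).det * ψ x| := by
  have hr0 : (0 : ℝ) < r := by positivity
  have hr1 : (1 : ℝ) < r := by exact_mod_cast hr
  have hp0 : 0 < p := hr0.trans hrp
  have hs2 : s < 2 := by
    rw [hs]
    have : 0 < 2 / (r : ℝ) := by positivity
    linarith
  obtain ⟨θ, hθ1, hθ2⟩ := exists_between (one_div_lt_one_div_of_lt hr0 hrp)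
  have hθ0 : 0 < θ := (one_div_pos.2 hp0).trans hθ1
  obtain ⟨C, -, hC⟩ := exists_sobNorm_sum_gridFn_le (N := N) (by omega) (hr1.trans hrp).le hs1 hs2
  obtain ⟨c, hc0, hc⟩ := exists_integral_det_hessMinor_gridFn h hr
  obtain ⟨κ, hκ0, hκ⟩ := exists_coeff_le_abs_integral_det (r := r) (by omega)
  have t1 : Tendsto (fun n : ℕ => C * ((1 + r) * ((n : ℝ) ^ (-θ) + (n : ℝ) ^ (-(θ - 1 / p)))))
      atTop (𝓝 0) := by
    simpa using ((((tendsto_rpow_neg_atTop hθ0).add (tendsto_rpow_neg_atTop (sub_pos.2 hθ1))).comp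
      tendsto_natCast_atTop_atTop).const_mul ((1 : ℝ) + r)).const_mul C
  have hθ3 : 0 < 1 - r * θ := by
    rw [lt_div_iff₀ hr0] at hθ2
    linarith
  have t2 : Tendsto (fun n : ℕ => |c| / κ * (n : ℝ) ^ (1 - r * θ)) atTop atTop :=
    ((tendsto_rpow_atTop hθ3).comp tendsto_natCast_atTop_atTop).const_mul_atTop
      (div_pos (abs_pos.2 hc0) hκ0)
  obtain ⟨n, hn1, hn2, hn3⟩ := ((t1.eventually_lt_const hε).and
    ((t2.eventually_ge_atTop K).and (eventually_gt_atTop 0))).exists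
  have hn0 : (0 : ℝ) < n := by exact_mod_cast hn3
  have hpos : ∀ j : ℕ, (0 : ℝ) < 2 ^ j := fun j => by positivity
  set v : ℕ → Euc N → ℝ := fun j => gridFn N (2 ^ j) ((2 : ℝ) ^ j) with hv
  have hvc : ∀ j, ContDiff ℝ 2 (v j) := fun j => contDiff_gridFn (n := 2) N (2 ^ j) (2 ^ j)
  set b : ℕ → ℝ := fun j => (n : ℝ) ^ (-θ) * ((2 : ℝ) ^ j) ^ (-s) with hb
  obtain ⟨δ, hδ, hδc⟩ : ∃ δ : ℝ, |δ| = 1 ∧ δ * c = |c| := by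
    rcases le_total 0 c with h' | h'
    · exact ⟨1, by simp, by rw [abs_of_nonneg h', one_mul]⟩
    · exact ⟨-1, by simp, by rw [abs_of_nonpos h', neg_one_mul]⟩
  obtain ⟨d, hd, hdn⟩ := hκ (volume.restrict Ω) (H := fun j x => b j • hessMinor h (v j) x)
    (fun j => (continuous_hessMinor h (hvc j)).const_smul (b j)) (ψ := fun x => δ * ψ x)
    (hψc.const_mul δ) hψs.mul_left n
  have hterm : ∀ j, ∫ x in Ω, (b j • hessMinor h (v j) x).det * (δ * ψ x) =
      |c| * ((n : ℝ) ^ (-θ)) ^ r := by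
    intro j
    simp_rw [Matrix.det_smul, Fintype.card_fin, mul_assoc, mul_left_comm _ δ]
    rw [integral_const_mul, integral_const_mul, hv,
      setIntegral_det_hessMinor_gridFn h hr hΩ hψ (hpos j) (by simp), hc _ _ (hpos j),
      Nat.cast_pow, Nat.cast_ofNat, div_self (hpos j).ne', one_pow, mul_one, mul_left_comm,
      ← mul_assoc δ, hδc, mul_left_comm]
    congr 1
    have e : (((2 : ℝ) ^ j) ^ (-s)) ^ r * ((2 : ℝ) ^ j) ^ (2 * r - 2) = 1 := by
      rw [← Real.rpow_mul_natCast (hpos j).le, ← Real.rpow_natCast _ (2 * r - 2),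
        ← Real.rpow_add (hpos j), Nat.cast_sub (by omega), hs]
      push_cast
      rw [show -(2 - 2 / (r : ℝ)) * r + (2 * r - 2) = 0 by field_simp; ring, Real.rpow_zero]
    rw [hb, mul_pow, mul_assoc, e, mul_one]
  refine ⟨∑ j ∈ Finset.range n, (d j * b j) • v j, ?_,
    ((hC Ω n ((1 + r) * (n : ℝ) ^ (-θ)) _ (by positivity) fun j => ?_).trans_eq ?_).trans_lt hn1,
    hn2.trans ?_⟩
  · rw [Finset.sum_fn]
    exact ContDiff.sum fun j _ => (hvc j).const_smul (d j * b j)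
  · rw [abs_mul, abs_of_nonneg (by positivity : 0 ≤ b j), mul_assoc]
    exact mul_le_mul_of_nonneg_right (hd j) (by positivity)
  · rw [neg_sub, sub_eq_add_neg, Real.rpow_add hn0]
    ring
  · rw [Finset.sum_congr rfl fun j _ => hterm j, Finset.sum_const, Finset.card_range,
      nsmul_eq_mul] at hdn
    simp_rw [hessMinor_sum_smul h _ _ hvc]
    simp_rw [smul_smul, mul_left_comm _ δ] at hdn
    rw [integral_const_mul, abs_mul, hδ, one_mul, ← Real.rpow_mul_natCast hn0.le] at hdn
    rw [div_mul_eq_mul_div, div_le_iff₀ hκ0, mul_comm _ κ]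
    refine le_of_eq_of_le ?_ hdn
    rw [mul_left_comm, ← Real.rpow_one_add' hn0.le (by linarith)]
    ring_nf

theorem sobNorm_nonneg {N : ℕ} (Ω : Set (Euc N)) (s p : ℝ) (u : Euc N → ℝ) :
    0 ≤ sobNorm Ω s p u := by
  have h1 : 0 ≤ intSobNorm Ω ⌊s⌋₊ p u :=
    Finset.sum_nonneg fun j _ => Real.rpow_nonneg (integral_nonneg fun x => by positivity) _
  unfold sobNorm
  split_ifs
  · exact h1
  · exact add_nonneg h1 (Real.rpow_nonneg
      (integral_nonneg fun x => integral_nonneg fun y => by positivity) _)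

theorem exists_seq_tendsto_of_unbounded {α : Type*} {P : α → Prop} {f g : α → ℝ}
    (hf : ∀ u, 0 ≤ f u) (H : ∀ ε > 0, ∀ K, ∃ u, P u ∧ f u < ε ∧ K ≤ g u) :
    ∃ u : ℕ → α, (∀ k, P (u k)) ∧ Tendsto (fun k => f (u k)) atTop (𝓝 0) ∧
      Tendsto (fun k => g (u k)) atTop atTop := by
  choose u hP hlt hK using fun k : ℕ => H (1 / ((k : ℝ) + 1)) Nat.one_div_pos_of_nat k
  exact ⟨u, hP, squeeze_zero (fun k => hf _) (fun k => (hlt k).le)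
    tendsto_one_div_add_atTop_nhds_zero_nat,
    tendsto_atTop_mono hK tendsto_natCast_atTop_atTop⟩

theorem exists_seq_tendsto_of_unbounded_abs {α : Type*} {P : α → Prop} {f g : α → ℝ}
    (hf : ∀ u, 0 ≤ f u) (H : ∀ ε > 0, ∀ K, ∃ u, P u ∧ f u < ε ∧ K ≤ |g u|) :
    ∃ (δ : ℝ) (u : ℕ → α), (∀ k, P (u k)) ∧ Tendsto (fun k => f (u k)) atTop (𝓝 0) ∧
      Tendsto (fun k => δ * g (u k)) atTop atTop := by
  by_cases h : ∀ ε > 0, ∀ K, ∃ u, P u ∧ f u < ε ∧ K ≤ 1 * g u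
  · exact ⟨1, exists_seq_tendsto_of_unbounded hf h⟩
  · push Not at h
    obtain ⟨ε₀, hε₀, K₀, h⟩ := h
    refine ⟨-1, exists_seq_tendsto_of_unbounded (P := P) (g := fun u => -1 * g u) hf
      fun ε hε K => ?_⟩
    obtain ⟨u, hP, hu, hK⟩ := H (min ε ε₀) (lt_min hε hε₀) (max K K₀)
    refine ⟨u, hP, hu.trans_le (min_le_left _ _), ?_⟩
    have h1 := h u hP (hu.trans_le (min_le_right _ _))
    rcases le_abs'.1 hK with h2 | h2
    · change K ≤ -1 * g u
      linarith [le_max_left K K₀]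
    · linarith [le_max_right K K₀]

/-- Theorem 4.14 (reinforced optimality for the Hessian minors, scalar case): if
`W^{s,p}(Ω) ⊄ W^{2-2/r,r}(Ω)` (equivalently, `s - 2 + 2/r < max{0, N/p - N/r}` or
(`p > r` and `s = 2 - 2/r` non-integer)), then there are scalar `u_k ∈ C^2(Ω̄)` and
`ψ ∈ C_c^∞(Ω)` with `‖u_k‖_{W^{s,p}} → 0` and `∫_Ω M^{α'}_{α'}(D^2 u_k) ψ → ∞`, where
`α' = (1,…,r)` and `M^{α'}_{α'}(D^2 u)` is the leading principal `r × r` Hessian minor. -/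
theorem stmt16 (N r : ℕ) (hN : 2 ≤ N) (hr1 : 1 < r) (hrN : r ≤ N)
    (Ω : Set (Euc N)) (hΩ : IsSmoothDomain Ω)
    (hbox : {x : Euc N | ∀ i, |x i| < 8} ⊆ Ω)
    (p s : ℝ) (hp1 : 1 < p) (hs0 : 0 < s)
    (hnotembed :
      s - 2 + 2 / (r : ℝ) < max 0 ((N : ℝ) / p - (N : ℝ) / r) ∨
        ((r : ℝ) < p ∧ s = 2 - 2 / (r : ℝ) ∧ ¬∃ k : ℕ, s = k)) :
    ∃ (u : ℕ → Euc N → ℝ) (ψ : Euc N → ℝ),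
      (∀ k, ContDiffOn ℝ 2 (u k) (closure Ω)) ∧ IsCinfc Ω ψ ∧
      Tendsto (fun k => sobNorm Ω s p (u k)) atTop (𝓝 0) ∧
      Tendsto
        (fun k => ∫ x in Ω,
          Matrix.det (Matrix.of fun a b : Fin r =>
            pderiv' (Fin.castLE hrN a) (pderiv' (Fin.castLE hrN b) (u k)) x) * ψ x)
        atTop atTop := by
  have hr0 : (0 : ℝ) < r := by positivity
  have hp0 : 0 < p := by linarith
  have hcube : ∀ ρ : ℝ, ρ < 8 → cube N ρ ⊆ Ω := fun ρ hρ x hx => hbox fun i => (hx i).trans_lt hρ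
  obtain ⟨ψ, hψ, hψ1⟩ := exists_isCinfc_eq_sq (hcube 2 (by norm_num))
    (Fin.castLE hrN ⟨0, by omega⟩)
  have hΩ1 := hcube 1 (by norm_num)
  have key : ∀ ε > 0, ∀ K, ∃ u : Euc N → ℝ, ContDiff ℝ 2 u ∧ sobNorm Ω s p u < ε ∧
      K ≤ |∫ x in Ω, (hessMinor hrN u x).det * ψ x| := by
    intro ε hε K
    rcases hnotembed with h | ⟨hrp, hs, hint⟩
    · rcases lt_max_iff.1 h with h | h
      · refine exists_sobNorm_lt_of_single_scale hrN hr1 hΩ1 hψ1 hp0 hs0.le le_rfl (L := fun k => k)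
          (fun k hk => ?_) (by linarith) hε K
        rw [neg_zero, Real.rpow_zero, div_self (by positivity)]
      · refine exists_sobNorm_lt_of_single_scale hrN hr1 hΩ1 hψ1 hp0 hs0.le zero_le_one
          (L := fun _ => 1) (fun k hk => ?_) (by linarith) hε K
        rw [Real.rpow_neg_one, Nat.cast_one, one_div]
    · refine exists_sobNorm_lt_of_multi_scale hrN hr1 hΩ1 hψ.1.continuous hψ.2.1 hψ1 hrp hs ?_ hε K
      have hr3 : r ≠ 2 := by
        rintro rfl
        exact hint ⟨1, by rw [hs]; norm_num⟩
      have hr3' : (3 : ℝ) ≤ r := by exact_mod_cast (by omega : 3 ≤ r)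
      have : 2 / (r : ℝ) < 1 := (div_lt_one hr0).2 (by linarith)
      linarith
  obtain ⟨δ, u, hu, hu0, hu1⟩ := exists_seq_tendsto_of_unbounded_abs (sobNorm_nonneg Ω s p) key
  refine ⟨u, fun x => δ * ψ x, fun k => (hu k).contDiffOn,
    ⟨contDiff_const.mul hψ.1, hψ.2.1.mul_left,
      (tsupport_mul_subset_right (f := fun _ => δ)).trans hψ.2.2⟩, hu0, hu1.congr fun k => ?_⟩
  rw [← integral_const_mul]
  congr 1
  ext x
  rw [mul_left_comm]
  rfl
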